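/- arXiv:2404.13687 — 7 statements merged into one kernel-verified Lean document; each statement's English description precedes it below -/
import Mathlib

section
/- Let G=(V_∃,V_∀,E,Ω) be a parity game with priorities {1,…,k}, where k is even. Then the winning region of player ∃ satisfies Win_G = νX_k.μX_{k-1}.….μX_1. ⋃_{1≤i≤k} (Ω^{-1}(i) ∩ Cpre(X_i)), where Ω^{-1}(i)={v∈V | Ω(v)=i} and the nested fixpoint is taken over subsets of V. -/
open Filter

/-- The history (list of nodes strictly before position `n`) of a play. -/
def histList {V : Type*} (p : ℕ → V) (n : ℕ) : List V := List.ofFn (fun j : Fin n => p (j : ℕ))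

/-- Player ∃ wins an infinite play of a parity game iff the maximal priority
occurring infinitely often is even. -/
def ParityWinsPlay {V : Type*} (Ω : V → ℕ) (π : ℕ → V) : Prop :=
  ∃ m, Even m ∧ (∃ᶠ i in atTop, Ω (π i) = m) ∧ ∀ q, q > m → ∀ᶠ i in atTop, Ω (π i) ≠ q

/-- Player ∃ has a winning strategy from `v`: a strategy (a function of the history and the
current node) that prescribes legal moves, never gets stuck at a node of player ∃ along
compatible finite plays, and such that every compatible infinite play from `v` is winning. -/
def WinsFrom {V : Type*} (Vex : Set V) (E : V → Set V) (WinPlay : (ℕ → V) → Prop)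
    (v : V) : Prop :=
  ∃ σ : List V → V → V,
    (∀ (h : List V) (u : V), u ∈ Vex → (E u).Nonempty → σ h u ∈ E u) ∧
    (∀ (p : ℕ → V) (n : ℕ), p 0 = v → (∀ i, i < n → p (i+1) ∈ E (p i)) →
        (∀ i, i < n → p i ∈ Vex → p (i+1) = σ (histList p i) (p i)) →
        p n ∈ Vex → (E (p n)).Nonempty) ∧
    (∀ π : ℕ → V, π 0 = v → (∀ i, π (i+1) ∈ E (π i)) →
        (∀ i, π i ∈ Vex → π (i+1) = σ (histList π i) (π i)) → WinPlay π)

/-- Semantics of the nested fixpoint `ν X_k. μ X_{k-1}. … . μ X_1. f(X_1,…,X_k)`: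
`fpSem f i X` is `⟦e⟧_i(X_{i+1},…,X_k)` (variable `X_j` of the paper is coordinate `j-1`);
at stage `i+1` the variable `X_{i+1}` is bound by a least fixpoint if `i+1` is odd and by a
greatest fixpoint if `i+1` is even. -/
def fpSem {U : Type*} {k : ℕ} (f : (Fin k → Set U) → Set U) : ℕ → (Fin k → Set U) → Set U
  | 0, X => f X
  | (i+1), X =>
      if (i+1) % 2 = 1 then
        ⋂₀ {Y : Set U | fpSem f i (fun j => if (j : ℕ) = i then Y else X j) ⊆ Y}
      else
        ⋃₀ {Y : Set U | Y ⊆ fpSem f i (fun j => if (j : ℕ) = i then Y else X j)}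

/-- The controllable predecessor function: one-step attraction for player ∃. -/
def Cpre {V : Type*} (Vex : Set V) (E : V → Set V) (X : Set V) : Set V :=
  {v | (v ∈ Vex ∧ ∃ w ∈ E v, w ∈ X) ∨ (v ∉ Vex ∧ ∀ w ∈ E v, w ∈ X)}


open Classical in
noncomputable def fpG {U : Type*} {k : ℕ} (M : ℕ → Prop) (f : (Fin k → Set U) → Set U) :
    ℕ → (Fin k → Set U) → Set U
  | 0, X => f X
  | (i+1), X =>
      if M (i+1) then
        ⋂₀ {Y : Set U | fpG M f i (fun j => if (j : ℕ) = i then Y else X j) ⊆ Y}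
      else
        ⋃₀ {Y : Set U | Y ⊆ fpG M f i (fun j => if (j : ℕ) = i then Y else X j)}

theorem fpG_eq {U : Type*} {k : ℕ} (f : (Fin k → Set U) → Set U) (i : ℕ) (X : Fin k → Set U) :
    fpSem f i X = fpG (fun n => n % 2 = 1) f i X := by
  induction i generalizing X with
  | zero => rfl
  | succ i ih =>
    simp only [fpSem, fpG, ih]
    by_cases h : (i + 1) % 2 = 1
    · rw [if_pos h, if_pos h]
    · rw [if_neg h, if_neg h]

theorem fpG_compl {U : Type*} {k : ℕ} (M : ℕ → Prop) (f g : (Fin k → Set U) → Set U)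
    (h : ∀ X, (f X)ᶜ = g (fun j => (X j)ᶜ)) (i : ℕ) (X : Fin k → Set U) :
    (fpG M f i X)ᶜ = fpG (fun n => ¬ M n) g i (fun j => (X j)ᶜ) := by
  induction i generalizing X with
  | zero => exact h X
  | succ i ih =>
    have key : ∀ Y : Set U, fpG (fun n => ¬ M n) g i (fun j => if (j : ℕ) = i then Yᶜ else (X j)ᶜ)
        = (fpG M f i (fun j => if (j : ℕ) = i then Y else X j))ᶜ := by
      intro Y
      rw [ih]
      congr 1
      funext j
      split_ifs <;> rfl
    have key2 : ∀ Y : Set U, fpG (fun n => ¬ M n) g i (fun j => if (j : ℕ) = i then Y else (X j)ᶜ)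
        = (fpG M f i (fun j => if (j : ℕ) = i then Yᶜ else X j))ᶜ := by
      intro Y
      rw [← key, compl_compl]
    by_cases hM : M (i+1)
    · simp only [fpG, hM, if_true, not_true, if_false]
      ext x
      simp only [Set.mem_compl_iff, Set.mem_sInter, Set.mem_sUnion, Set.mem_ofPred_eq, key2]
      push Not
      constructor
      · rintro ⟨Y, h1, h2⟩
        exact ⟨Yᶜ, by rw [compl_compl]; exact Set.compl_subset_compl.2 h1, h2⟩
      · rintro ⟨Y, h1, h2⟩
        exact ⟨Yᶜ, Set.subset_compl_comm.1 h1, fun h => h h2⟩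
    · simp only [fpG, hM, if_true, not_false_iff, if_false]
      ext x
      simp only [Set.mem_compl_iff, Set.mem_sInter, Set.mem_sUnion, Set.mem_ofPred_eq, key2]
      push Not
      constructor
      · intro H Y hY
        by_contra hx
        exact H Yᶜ (Set.compl_subset_comm.1 hY) hx
      · intro H Y hY hx
        exact H Yᶜ (by rw [compl_compl]; exact Set.compl_subset_compl.2 hY) hx

theorem fpG_mono {U : Type*} {k : ℕ} (M : ℕ → Prop) (f : (Fin k → Set U) → Set U)
    (hf : Monotone f) (i : ℕ) : Monotone (fpG M f i) := by
  induction i with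
  | zero => exact hf
  | succ i ih =>
    intro X X' h
    have key : ∀ Y : Set U, fpG M f i (fun j => if (j : ℕ) = i then Y else X j) ⊆
        fpG M f i (fun j => if (j : ℕ) = i then Y else X' j) := by
      intro Y
      apply ih
      intro j
      dsimp only
      split_ifs
      · exact le_rfl
      · exact h j
    by_cases hM : M (i+1)
    · simp only [fpG, hM, if_true]
      intro x hx Y hY
      exact hx Y ((key Y).trans hY)
    · simp only [fpG, hM, if_false]
      rintro x ⟨Y, hY, hx⟩
      exact ⟨Y, Set.Subset.trans hY (key Y), hx⟩

theorem Cpre_mono {V : Type*} (P : Set V) (E : V → Set V) {X Y : Set V} (h : X ⊆ Y) :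
    Cpre P E X ⊆ Cpre P E Y := by
  rintro v (⟨a, w, b, c⟩ | ⟨a, b⟩)
  · exact Or.inl ⟨a, w, b, h c⟩
  · exact Or.inr ⟨a, fun w hw => h (b w hw)⟩

theorem Cpre_compl {V : Type*} (P : Set V) (E : V → Set V) (X : Set V) :
    (Cpre P E X)ᶜ = Cpre Pᶜ E Xᶜ := by
  ext v
  by_cases h : v ∈ P <;> simp [Cpre, h]

def stepF {V : Type*} (k : ℕ) (P : Set V) (E : V → Set V) (Ω : V → ℕ) (X : Fin k → Set V) :
    Set V := ⋃ i : Fin k, ({v | Ω v = (i : ℕ) + 1} ∩ Cpre P E (X i))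

theorem mem_stepF {V : Type*} (k : ℕ) (P : Set V) (E : V → Set V) (Ω : V → ℕ)
    (X : Fin k → Set V) (v : V) (j : Fin k) (hj : Ω v = j + 1) :
    v ∈ stepF k P E Ω X ↔ v ∈ Cpre P E (X j) := by
  simp only [stepF, Set.mem_iUnion, Set.mem_inter_iff, Set.mem_ofPred_eq]
  constructor
  · rintro ⟨i, h1, h2⟩
    have : i = j := by ext; omega
    rwa [← this]
  · intro h
    exact ⟨j, hj, h⟩

theorem stepF_mono {V : Type*} (k : ℕ) (P : Set V) (E : V → Set V) (Ω : V → ℕ) :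
    Monotone (stepF k P E Ω) := by
  intro X Y h
  exact Set.iUnion_mono fun i => Set.inter_subset_inter_right _ (Cpre_mono P E (h i))

theorem stepF_compl {V : Type*} (k : ℕ) (P : Set V) (E : V → Set V) (Ω : V → ℕ)
    (hΩ : ∀ v : V, 1 ≤ Ω v ∧ Ω v ≤ k) (X : Fin k → Set V) :
    (stepF k P E Ω X)ᶜ = stepF k Pᶜ E Ω (fun j => (X j)ᶜ) := by
  ext v
  have h := hΩ v
  have hj : Ω v = ((⟨Ω v - 1, by omega⟩ : Fin k) : ℕ) + 1 := by simp; omega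
  rw [Set.mem_compl_iff, mem_stepF k P E Ω X v _ hj, mem_stepF k Pᶜ E Ω _ v _ hj, ← Cpre_compl]
  rfl

universe u

def Cert {V : Type u} {k : ℕ} (M : ℕ → Prop) (P : Set V) (E : V → Set V) (Ω : V → ℕ)
    (i : ℕ) (X : Fin k → Set V) (S : Set V) (ρ : ℕ → V → Ordinal.{u}) : Prop :=
  ∀ v ∈ S, (Ω v ≤ i → v ∈ Cpre P E {w | w ∈ S ∧ (∀ q, Ω v ≤ q → q ≤ i → ρ q w ≤ ρ q v) ∧
      (M (Ω v) → ρ (Ω v) w < ρ (Ω v) v)}) ∧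
    (∀ j : Fin k, Ω v = j + 1 → i < Ω v → v ∈ Cpre P E (X j))

theorem lex_collapse {V : Type u} (a b : V → Ordinal.{u}) :
    ∃ g : V → Ordinal.{u}, ∀ v w, (a v < a w → g v < g w) ∧
      (a v = a w → b v < b w → g v < g w) ∧ (a v = a w → b v ≤ b w → g v ≤ g w) := by
  let F : V → Ordinal.{u} ×ₗ Ordinal.{u} := fun v => toLex (a v, b v)
  have wf : WellFounded (InvImage (· < ·) F) := InvImage.wf F wellFounded_lt
  let R : V → V → Prop := InvImage (· < ·) F
  haveI : IsWellFounded V R := ⟨wf⟩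
  refine ⟨fun v => IsWellFounded.rank R v, fun v w => ?_⟩
  have lt : F v < F w → IsWellFounded.rank R v < IsWellFounded.rank R w := fun h => IsWellFounded.rank_lt_of_rel (r := R) h
  have h2 : a v = a w → b v < b w → IsWellFounded.rank R v < IsWellFounded.rank R w :=
    fun h h' => lt (Prod.Lex.toLex_lt_toLex.2 (Or.inr ⟨h, h'⟩))
  refine ⟨fun h => lt (Prod.Lex.toLex_lt_toLex.2 (Or.inl h)), h2, fun h h' => ?_⟩
  rcases h'.lt_or_eq with h' | h'
  · exact (h2 h h').le
  · have e : F v = F w := by simp only [F, h, h']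
    apply le_of_eq
    dsimp only
    rw [IsWellFounded.rank_eq R v, IsWellFounded.rank_eq R w]
    have : ∀ x, R x v ↔ R x w := by
      intro x; simp only [R, InvImage, e]
    have h3 : (fun x => R x v) = (fun x => R x w) := funext fun x => propext (this x)
    change (⨆ b : { b // (fun x => R x v) b }, _) = (⨆ b : { b // (fun x => R x w) b }, _)
    rw [h3]

theorem approx {V : Type u} (g : Set V → Set V) (hg : Monotone g) :
    ∃ (r : V → Ordinal.{u}) (Y : Ordinal.{u} → Set V),
      (∀ v ∈ ⋂₀ {Y : Set V | g Y ⊆ Y}, v ∈ g (Y (r v))) ∧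
      (∀ α, g (Y α) ⊆ ⋂₀ {Y : Set V | g Y ⊆ Y}) ∧
      (∀ α, ∀ w ∈ g (Y α), r w ≤ α) ∧
      (∀ α, Y α ⊆ ⋂₀ {Y : Set V | g Y ⊆ Y}) ∧
      (∀ α, ∀ w ∈ Y α, r w < α) := by
  let Y : Ordinal.{u} → Set V :=
    wellFounded_lt.fix (fun α ih => ⋃ β : Set.Iio α, g (ih β.1 β.2))
  have hY : ∀ α, Y α = ⋃ β : Set.Iio α, g (Y β.1) := fun α => wellFounded_lt.fix_eq _ α
  let r : V → Ordinal.{u} := fun v => sInf {α | v ∈ g (Y α)}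
  have hr : ∀ v α, v ∈ g (Y α) → r v ≤ α := fun v α h => csInf_le' h
  have hr' : ∀ v α, v ∈ g (Y α) → v ∈ g (Y (r v)) := fun v α h =>
    csInf_mem (s := {α | v ∈ g (Y α)}) ⟨α, h⟩
  have hlt : ∀ α, ∀ w ∈ Y α, r w < α := by
    intro α w hw
    rw [hY] at hw
    obtain ⟨β, h⟩ := Set.mem_iUnion.1 hw
    exact (hr _ _ h).trans_lt β.2
  have hsub : ∀ α, Y α ⊆ ⋂₀ {Y : Set V | g Y ⊆ Y} ∧ g (Y α) ⊆ ⋂₀ {Y : Set V | g Y ⊆ Y} := by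
    intro α
    induction α using WellFoundedLT.induction with
    | ind α ih =>
      have h1 : Y α ⊆ ⋂₀ {Y : Set V | g Y ⊆ Y} := by
        rw [hY]
        exact Set.iUnion_subset fun β => (ih β.1 β.2).2
      refine ⟨h1, fun w hw Z hZ => hZ (hg ?_ hw)⟩
      exact fun x hx => h1 hx Z hZ
  refine ⟨r, Y, ?_, fun α => (hsub α).2, fun α w => hr w α, fun α => (hsub α).1, hlt⟩
  intro v hv
  let A : Ordinal.{u} := ⨆ v, Order.succ (r v)
  have hA : ∀ v, r v < A := fun v =>
    (Order.lt_succ (r v)).trans_le (Ordinal.le_iSup (fun v => Order.succ (r v)) v)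
  have hpre : g (Y A) ⊆ Y A := by
    intro w hw
    rw [hY]
    exact Set.mem_iUnion.2 ⟨⟨r w, hA w⟩, hr' w A hw⟩
  have := hv (Y A) hpre
  rw [hY] at this
  obtain ⟨β, h⟩ := Set.mem_iUnion.1 this
  exact hr' v _ h

theorem exists_cert {V : Type u} (k : ℕ) (M : ℕ → Prop) (P : Set V) (E : V → Set V) (Ω : V → ℕ)
    (hΩ : ∀ v : V, 1 ≤ Ω v ∧ Ω v ≤ k) (i : ℕ) (X : Fin k → Set V) :
    ∃ ρ, Cert M P E Ω i X (fpG M (stepF k P E Ω) i X) ρ := by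
  induction i generalizing X with
  | zero =>
    refine ⟨fun _ _ => 0, fun v hv => ⟨fun h => ?_, fun j hj _ => ?_⟩⟩
    · have := hΩ v; omega
    · exact (mem_stepF k P E Ω X v j hj).1 hv
  | succ i ih =>
    set g : Set V → Set V :=
      fun Y => fpG M (stepF k P E Ω) i (fun j => if (j : ℕ) = i then Y else X j) with hgdef
    have hg : Monotone g := by
      intro Y Y' h
      apply fpG_mono M _ (stepF_mono k P E Ω)
      intro j
      dsimp only
      split_ifs
      · exact h
      · exact le_rfl
    have ih' : ∀ Y, ∃ ρ, Cert M P E Ω i (fun j : Fin k => if (j : ℕ) = i then Y else X j) (g Y) ρ :=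
      fun Y => ih _
    by_cases hM : M (i+1)
    · have hS : fpG M (stepF k P E Ω) (i+1) X = ⋂₀ {Y : Set V | g Y ⊆ Y} := by
        simp only [fpG, hM, if_true, hgdef]
      rw [hS]
      obtain ⟨r, Y, h1, h2, h3, h4, h5⟩ := approx g hg
      set S := ⋂₀ {Y : Set V | g Y ⊆ Y}
      choose ρ hρ using fun α => ih' (Y α)
      choose L hL using fun q => lex_collapse r (fun v => ρ (r v) q v)
      refine ⟨fun q => if q = i+1 then r else L q, fun v hv => ⟨fun hle => ?_, fun j hj hlt => ?_⟩⟩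
      · obtain ⟨c1, c2⟩ := hρ (r v) v (h1 v hv)
        rcases Nat.lt_or_ge i (Ω v) with hi | hi
        · have e : Ω v = i + 1 := by omega
          have hk := (hΩ v).2
          have c := c2 ⟨i, by omega⟩ e hi
          simp only [if_true] at c
          refine Cpre_mono P E ?_ c
          intro w hw
          refine ⟨h4 _ hw, fun q hq hq' => ?_, fun _ => ?_⟩
          · have : q = i + 1 := by omega
            simp only [this, if_true]
            exact (h5 _ w hw).le
          · simp only [e, if_true]
            exact h5 _ w hw
        · refine Cpre_mono P E ?_ (c1 hi)
          rintro w ⟨w1, w2, w3⟩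
          have hr := h3 _ w w1
          refine ⟨h2 _ w1, fun q hq hq' => ?_, fun hm => ?_⟩
          · dsimp only
            split_ifs with hqi
            · exact hr
            · rcases hr.lt_or_eq with hr | hr
              · exact ((hL q w v).1 hr).le
              · refine (hL q w v).2.2 hr ?_
                rw [hr]
                exact w2 q hq (by omega)
          · have hne : Ω v ≠ i + 1 := by omega
            simp only [if_neg hne]
            rcases hr.lt_or_eq with hr | hr
            · exact (hL _ w v).1 hr
            · refine (hL _ w v).2.1 hr ?_
              rw [hr]
              exact w3 hm
      · obtain ⟨c1, c2⟩ := hρ (r v) v (h1 v hv)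
        have c := c2 j hj (by omega)
        have hne : (j : ℕ) ≠ i := by omega
        simpa only [if_neg hne] using c
    · have hS : fpG M (stepF k P E Ω) (i+1) X = ⋃₀ {Y : Set V | Y ⊆ g Y} := by
        simp only [fpG, hM, if_false, hgdef]
      rw [hS]
      set S := ⋃₀ {Y : Set V | Y ⊆ g Y} with hSdef
      have s1 : S ⊆ g S := by
        rintro x ⟨Y, hY, hx⟩
        exact hg (Set.subset_sUnion_of_mem hY) (hY hx)
      have s2 : g S ⊆ S := Set.subset_sUnion_of_mem (show g S ⊆ g (g S) from hg s1)
      obtain ⟨ρ, hρ⟩ := ih' S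
      refine ⟨fun q => if q = i+1 then fun _ => 0 else ρ q,
        fun v hv => ⟨fun hle => ?_, fun j hj hlt => ?_⟩⟩
      · obtain ⟨c1, c2⟩ := hρ v (s1 hv)
        rcases Nat.lt_or_ge i (Ω v) with hi | hi
        · have e : Ω v = i + 1 := by omega
          have hk := (hΩ v).2
          have c := c2 ⟨i, by omega⟩ e hi
          simp only [if_true] at c
          refine Cpre_mono P E ?_ c
          intro w hw
          refine ⟨hw, fun q hq hq' => ?_, fun hm => ?_⟩
          · have : q = i + 1 := by omega
            simp [this]
          · rw [e] at hm
            exact absurd hm hM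
        · refine Cpre_mono P E ?_ (c1 hi)
          rintro w ⟨w1, w2, w3⟩
          refine ⟨s2 w1, fun q hq hq' => ?_, fun hm => ?_⟩
          · dsimp only
            split_ifs with hqi
            · exact le_rfl
            · exact w2 q hq (by omega)
          · have hne : Ω v ≠ i + 1 := by omega
            simp only [if_neg hne]
            exact w3 hm
      · obtain ⟨c1, c2⟩ := hρ v (s1 hv)
        have c := c2 j hj (by omega)
        have hne : (j : ℕ) ≠ i := by omega
        simpa only [if_neg hne] using c

theorem no_descent (a : ℕ → Ordinal.{u}) (N : ℕ) (h1 : ∀ n, N ≤ n → a (n+1) ≤ a n)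
    (h2 : ∀ n, ∃ m, n ≤ m ∧ a (m+1) < a m) : False := by
  have anti : ∀ n m, N ≤ n → n ≤ m → a m ≤ a n := by
    intro n m hn hm
    induction m, hm using Nat.le_induction with
    | base => exact le_rfl
    | succ m hm ih => exact (h1 m (hn.trans hm)).trans ih
  have : ∀ x : Ordinal.{u}, ∀ n, N ≤ n → a n = x → False := by
    intro x
    induction x using WellFoundedLT.induction with
    | ind x ih =>
      intro n hn hx
      obtain ⟨m, hm, hlt⟩ := h2 n
      exact ih (a (m+1)) (hlt.trans_le (hx ▸ anti n m hn hm)) (m+1) (by omega) rfl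
  exact this _ N le_rfl rfl

theorem exists_pos {V : Type u} (k : ℕ) (M : ℕ → Prop) (P : Set V) (E : V → Set V) (Ω : V → ℕ)
    (hNE : ∀ v : V, (E v).Nonempty)
    (hΩ : ∀ v : V, 1 ≤ Ω v ∧ Ω v ≤ k) (X : Fin k → Set V) :
    ∃ τ : V → V, (∀ v, τ v ∈ E v) ∧ ∀ π : ℕ → V, π 0 ∈ fpG M (stepF k P E Ω) k X →
      (∀ i, π (i+1) ∈ E (π i)) → (∀ i, π i ∈ P → π (i+1) = τ (π i)) →
      ∀ m, M m → (∃ᶠ i in atTop, Ω (π i) = m) → (∀ q, q > m → ∀ᶠ i in atTop, Ω (π i) ≠ q) →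
        False := by
  obtain ⟨ρ, hρ⟩ := exists_cert k M P E Ω hΩ k X
  set S := fpG M (stepF k P E Ω) k X
  let G : V → Set V := fun v => {w | w ∈ S ∧ (∀ q, Ω v ≤ q → q ≤ k → ρ q w ≤ ρ q v) ∧
      (M (Ω v) → ρ (Ω v) w < ρ (Ω v) v)}
  have hG : ∀ v ∈ S, v ∈ Cpre P E (G v) := fun v hv => (hρ v hv).1 (hΩ v).2
  have : ∀ v, ∃ w, w ∈ E v ∧ (v ∈ S → v ∈ P → w ∈ G v) := by
    intro v
    by_cases h : v ∈ S ∧ v ∈ P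
    · rcases hG v h.1 with ⟨_, w, h1, h2⟩ | ⟨h1, _⟩
      · exact ⟨w, h1, fun _ _ => h2⟩
      · exact absurd h.2 h1
    · obtain ⟨w, hw⟩ := hNE v
      exact ⟨w, hw, fun a b => absurd ⟨a, b⟩ h⟩
  choose τ t1 t2 using this
  refine ⟨τ, t1, fun π h0 hE hP m hm hf hev => ?_⟩
  have step : ∀ i, π i ∈ S → π (i+1) ∈ G (π i) := by
    intro i hi
    by_cases hp : π i ∈ P
    · rw [hP i hp]
      exact t2 _ hi hp
    · rcases hG _ hi with ⟨h, _⟩ | ⟨_, h⟩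
      · exact absurd h hp
      · exact h _ (hE i)
  have inS : ∀ i, π i ∈ S := by
    intro i
    induction i with
    | zero => exact h0
    | succ i ih => exact (step i ih).1
  have hev2 : ∀ᶠ i in atTop, Ω (π i) ≤ m := by
    have : ∀ᶠ i in atTop, ∀ q ∈ Finset.Ioc m k, Ω (π i) ≠ q := by
      rw [Filter.eventually_all_finset]
      intro q hq
      exact hev q (Finset.mem_Ioc.1 hq).1
    filter_upwards [this] with i hi
    by_contra hlt
    exact hi _ (Finset.mem_Ioc.2 ⟨by omega, (hΩ _).2⟩) rfl
  obtain ⟨N, hN⟩ := Filter.eventually_atTop.1 hev2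
  have hmk : m ≤ k := by
    obtain ⟨i, hi⟩ := hf.exists
    exact hi ▸ (hΩ _).2
  refine no_descent (fun n => ρ m (π n)) N (fun n hn => (step n (inS n)).2.1 m (hN n hn) hmk) ?_
  intro n
  obtain ⟨i, hi, e⟩ := Filter.frequently_atTop.1 hf n
  refine ⟨i, hi, ?_⟩
  have := (step i (inS i)).2.2
  rw [e] at this
  exact this hm

theorem exists_max {V : Type*} (k : ℕ) (Ω : V → ℕ) (hΩ : ∀ v : V, 1 ≤ Ω v ∧ Ω v ≤ k)
    (π : ℕ → V) :
    ∃ m, (∃ᶠ i in atTop, Ω (π i) = m) ∧ (∀ q, q > m → ∀ᶠ i in atTop, Ω (π i) ≠ q) := by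
  classical
  have hex : ∃ m, m ≤ k ∧ ∃ᶠ i in atTop, Ω (π i) = m := by
    by_contra hno
    push Not at hno
    have : ∀ᶠ i in atTop, ∀ q ∈ Finset.Iic k, Ω (π i) ≠ q := by
      rw [Filter.eventually_all_finset]
      intro q hq
      exact Filter.not_frequently.1 (by simpa using hno q (Finset.mem_Iic.1 hq))
    obtain ⟨i, hi⟩ := this.exists
    exact hi _ (Finset.mem_Iic.2 (hΩ _).2) rfl
  obtain ⟨m0, hm0, hf0⟩ := hex
  let Q : ℕ → Prop := fun m => ∃ᶠ i in atTop, Ω (π i) = m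
  refine ⟨Nat.findGreatest Q k, Nat.findGreatest_spec (P := Q) hm0 hf0, fun q hq => ?_⟩
  apply Filter.not_frequently.1
  intro h
  have hqk : q ≤ k := by
    obtain ⟨i, hi⟩ := h.exists
    exact hi ▸ (hΩ _).2
  exact Nat.findGreatest_is_greatest hq hqk h

/-- Walukiewicz' fixpoint characterization of the winning region of player ∃ in a parity
game with priorities `{1,…,k}` (`k` even):
`Win_G = ν X_k. μ X_{k-1}. … . μ X_1. ⋃_{1 ≤ i ≤ k} (Ω⁻¹(i) ∩ Cpre(X_i))`. -/
theorem statement0 {V : Type*} (k : ℕ) (hk : Even k)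
    (Vex : Set V) (E : V → Set V) (Ω : V → ℕ)
    (hNE : ∀ v : V, (E v).Nonempty)
    (hΩ : ∀ v : V, 1 ≤ Ω v ∧ Ω v ≤ k) :
    {v | WinsFrom Vex E (ParityWinsPlay Ω) v} =
      fpSem (fun X : Fin k → Set V =>
          ⋃ i : Fin k, ({v | Ω v = (i : ℕ) + 1} ∩ Cpre Vex E (X i)))
        k (fun _ => ∅) :=  by
  have hf : (fun X : Fin k → Set V =>
      ⋃ i : Fin k, ({v | Ω v = (i : ℕ) + 1} ∩ Cpre Vex E (X i))) = stepF k Vex E Ω := rfl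
  rw [hf, fpG_eq]
  ext v
  constructor
  · rintro ⟨σ, s1, -, s3⟩
    by_contra hv
    rw [← Set.mem_compl_iff, fpG_compl _ _ _ (stepF_compl k Vex E Ω hΩ)] at hv
    obtain ⟨τ, t1, t2⟩ := exists_pos k (fun n => ¬ (n % 2 = 1)) Vexᶜ E Ω hNE hΩ
      (fun _ : Fin k => (∅ : Set V)ᶜ)
    classical
    let st : ℕ → List V × V := fun n => Nat.rec (([] : List V), v)
      (fun _ s => (s.1 ++ [s.2], if s.2 ∈ Vex then σ s.1 s.2 else τ s.2)) n
    let π : ℕ → V := fun n => (st n).2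
    have hst : ∀ n, st (n+1) = ((st n).1 ++ [π n], if π n ∈ Vex then σ (st n).1 (π n)
      else τ (π n)) := fun n => rfl
    have hh : ∀ n, histList π n = (st n).1 := by
      intro n
      induction n with
      | zero => simp [histList, st]
      | succ n ih =>
        rw [hst, ← ih, histList, List.ofFn_succ', List.concat_eq_append]
        rfl
    have hs : ∀ n, π (n+1) = if π n ∈ Vex then σ (histList π n) (π n) else τ (π n) := by
      intro n
      rw [hh]
    have hE : ∀ n, π (n+1) ∈ E (π n) := by
      intro n
      rw [hs]
      split_ifs with h
      · exact s1 _ _ h (hNE _)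
      · exact t1 _
    obtain ⟨m, m1, m2, m3⟩ := s3 π rfl hE (fun i hi => by rw [hs, if_pos hi])
    exact t2 π hv hE (fun i hi => by rw [hs, if_neg hi]) m
      (by have := Nat.even_iff.1 m1; omega) m2 m3
  · intro hv
    obtain ⟨τ, t1, t2⟩ := exists_pos k (fun n => n % 2 = 1) Vex E Ω hNE hΩ
      (fun _ : Fin k => (∅ : Set V))
    refine ⟨fun _ => τ, fun _ u _ _ => t1 u, fun p n _ _ _ _ => hNE _, fun π h0 hE hP => ?_⟩
    obtain ⟨m, m1, m2⟩ := exists_max k Ω hΩ π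
    refine ⟨m, ?_, m1, m2⟩
    rw [Nat.even_iff]
    by_contra hm
    exact t2 π (by rw [h0]; exact hv) hE hP m (by omega) m1 m2
end

section
/- Let U be a set, k even, f:𝒫(U)^k→𝒫(U) monotone, and let e=νX_k.μX_{k-1}.….μX_1.f(X_1,…,X_k) be the induced nested fixpoint. Let G_e be the associated fixpoint game. Then for every u∈U, u∈e if and only if u is in the winning region of player ∃ in G_e. -/
open Filter

/-- Nodes of the fixpoint game `G_e`: elements of `U` (owned by ∃), tuples
`Ū ∈ 𝒫(U)^k` and pairs `(u,i) ∈ U × [k]` (both owned by ∀). -/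
abbrev FPGameNode (U : Type*) (k : ℕ) : Type _ := U ⊕ ((Fin k → Set U) ⊕ (U × Fin k))

/-- The nodes owned by player ∃ in the fixpoint game: exactly the elements of `U`. -/
def fgVex (U : Type*) (k : ℕ) : Set (FPGameNode U k) := {s | ∃ u : U, s = Sum.inl u}

/-- Moves of the fixpoint game: from `u ∈ U` to any tuple `Ū` with `u ∈ f(Ū)`;
from a tuple `Ū` to any `(u,i)` with `u ∈ U_i`; from `(u,i)` to `u`. -/
def fgE {U : Type*} {k : ℕ} (f : (Fin k → Set U) → Set U) :
    FPGameNode U k → Set (FPGameNode U k)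
  | Sum.inl u => {s | ∃ X : Fin k → Set U, s = Sum.inr (Sum.inl X) ∧ u ∈ f X}
  | Sum.inr (Sum.inl X) => {s | ∃ (u : U) (i : Fin k), s = Sum.inr (Sum.inr (u, i)) ∧ u ∈ X i}
  | Sum.inr (Sum.inr (u, _)) => {Sum.inl u}

/-- Priorities of the fixpoint game: `u ∈ U` and tuples have priority `0`,
a node `(u,i)` has priority `i` (1-based, i.e. coordinate `i` of `Fin k` gets `i+1`). -/
def fgPrio {U : Type*} {k : ℕ} : FPGameNode U k → ℕ
  | Sum.inl _ => 0
  | Sum.inr (Sum.inl _) => 0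
  | Sum.inr (Sum.inr (_, i)) => (i : ℕ) + 1

universe uu

/-- Generalized nested fixpoint: index `i` is a least fixpoint iff `P i`. -/
def gSem {U : Type uu} {k : ℕ} (P : ℕ → Prop) (f : (Fin k → Set U) → Set U) :
    ℕ → (Fin k → Set U) → Set U
  | 0, X => f X
  | (i+1), X => {u |
      (P i → u ∈ ⋂₀ {Y : Set U | gSem P f i (fun j => if (j : ℕ) = i then Y else X j) ⊆ Y}) ∧
      (¬ P i → u ∈ ⋃₀ {Y : Set U | Y ⊆ gSem P f i (fun j => if (j : ℕ) = i then Y else X j)})}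

def DecR (P : ℕ → Prop) (j : ℕ) (a b : ℕ → Ordinal.{uu}) : Prop :=
  (∃ c, j ≤ c ∧ a c < b c ∧ ∀ c', c < c' → a c' = b c') ∨ (¬ P j ∧ ∀ c, j ≤ c → a c = b c)

theorem gSem_mu {U : Type uu} {k : ℕ} {P : ℕ → Prop} (f : (Fin k → Set U) → Set U) {i : ℕ}
    (h : P i) (X : Fin k → Set U) : gSem P f (i+1) X =
      ⋂₀ {Y : Set U | gSem P f i (fun j => if (j : ℕ) = i then Y else X j) ⊆ Y} := by
  ext u
  simp only [gSem, Set.mem_ofPred_eq, h, true_imp_iff, not_true, false_imp_iff, and_true]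

theorem gSem_nu {U : Type uu} {k : ℕ} {P : ℕ → Prop} (f : (Fin k → Set U) → Set U) {i : ℕ}
    (h : ¬ P i) (X : Fin k → Set U) : gSem P f (i+1) X =
      ⋃₀ {Y : Set U | Y ⊆ gSem P f i (fun j => if (j : ℕ) = i then Y else X j)} := by
  ext u
  simp only [gSem, Set.mem_ofPred_eq, h, true_imp_iff, not_false_iff, false_imp_iff, true_and]

theorem fpSem_eq_gSem {U : Type uu} {k : ℕ} (f : (Fin k → Set U) → Set U) (i : ℕ) :
    ∀ X, fpSem f i X = gSem (fun i => (i+1) % 2 = 1) f i X := by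
  induction i with
  | zero => intro X; rfl
  | succ i ih =>
    intro X
    by_cases h : (i+1) % 2 = 1
    · rw [gSem_mu (P := fun i => (i+1) % 2 = 1) f h]
      simp only [fpSem, if_pos h, ih]
    · rw [gSem_nu (P := fun i => (i+1) % 2 = 1) f h]
      simp only [fpSem, if_neg h, ih]

theorem gSem_mono {U : Type uu} {k : ℕ} (P : ℕ → Prop) (f : (Fin k → Set U) → Set U)
    (hf : ∀ X Y : Fin k → Set U, (∀ i, X i ⊆ Y i) → f X ⊆ f Y) (i : ℕ) :
    ∀ X Y : Fin k → Set U, (∀ i, X i ⊆ Y i) → gSem P f i X ⊆ gSem P f i Y := by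
  induction i with
  | zero => exact hf
  | succ i ih =>
    intro X Y h
    have key : ∀ S : Set U, gSem P f i (fun j => if (j : ℕ) = i then S else X j) ⊆
        gSem P f i (fun j => if (j : ℕ) = i then S else Y j) := by
      intro S
      apply ih
      intro j
      by_cases hj : (j : ℕ) = i
      · simp [hj]
      · simpa [hj] using h j
    by_cases hP : P i
    · rw [gSem_mu f hP, gSem_mu f hP]
      intro u hu S hS
      exact hu S ((key S).trans hS)
    · rw [gSem_nu f hP, gSem_nu f hP]
      rintro u ⟨S, hS, hu⟩
      exact ⟨S, hS.trans (key S), hu⟩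

theorem gSem_dual {U : Type uu} {k : ℕ} (P : ℕ → Prop) (f : (Fin k → Set U) → Set U) (i : ℕ) :
    ∀ X : Fin k → Set U, (gSem P f i X)ᶜ =
      gSem (fun i => ¬ P i) (fun Z => (f (fun j => (Z j)ᶜ))ᶜ) i (fun j => (X j)ᶜ) := by
  induction i with
  | zero => intro X; simp [gSem]
  | succ i ih =>
    intro X
    have key : ∀ S : Set U, gSem (fun i => ¬ P i) (fun Z => (f (fun j => (Z j)ᶜ))ᶜ) i
        (fun j => if (j : ℕ) = i then S else (X j)ᶜ) =
        (gSem P f i (fun j => if (j : ℕ) = i then Sᶜ else X j))ᶜ := by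
      intro S
      rw [ih]
      congr 1
      funext j
      split_ifs <;> simp
    by_cases hP : P i
    · rw [gSem_mu f hP, gSem_nu (P := fun i => ¬ P i) _ (not_not.2 hP)]
      ext u
      simp only [key, Set.mem_compl_iff, Set.mem_sInter, Set.mem_sUnion, Set.mem_ofPred_eq, not_forall]
      constructor
      · rintro ⟨S, hS, hu⟩
        exact ⟨Sᶜ, by rw [compl_compl]; exact Set.compl_subset_compl.2 hS, hu⟩
      · rintro ⟨S, hS, hu⟩
        exact ⟨Sᶜ, Set.subset_compl_comm.1 hS, not_not.2 hu⟩
    · rw [gSem_nu f hP, gSem_mu (P := fun i => ¬ P i) _ hP]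
      ext u
      simp only [key, Set.mem_compl_iff, Set.mem_sInter, Set.mem_sUnion, Set.mem_ofPred_eq, not_exists,
        not_and]
      constructor
      · intro h S hS
        by_contra hu
        exact h Sᶜ (Set.compl_subset_comm.1 hS) hu
      · intro h S hS hu
        exact h Sᶜ (by rw [compl_compl]; exact Set.compl_subset_compl.2 hS) hu

theorem lfp_rank {U : Type uu} (G : Set U → Set U) (hG : Monotone G) (L : Set U)
    (hL : L = ⋂₀ {Y | G Y ⊆ Y}) :
    ∃ r : U → Ordinal.{uu}, (∀ u ∈ L, u ∈ G {v | v ∈ L ∧ r v < r u}) ∧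
      ∀ α v, v ∈ G {w | w ∈ L ∧ r w < α} → v ∈ L ∧ r v ≤ α := by
  classical
  obtain ⟨A, hA⟩ : ∃ A : Ordinal.{uu} → Set U, ∀ α, A α = G {u | ∃ β, β < α ∧ u ∈ A β} := by
    refine ⟨WellFounded.fix (C := fun _ => Set U) (wellFounded_lt (α := Ordinal.{uu}))
      (fun α ih => G {u | ∃ β, ∃ h : β < α, u ∈ ih β h}), fun α => ?_⟩
    rw [WellFounded.fix_eq]
    congr 1
    ext u
    simp
  have hGL : G L ⊆ L := by
    rw [hL]
    intro u hu Y hY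
    exact hY (hG (Set.sInter_subset_of_mem hY) hu)
  have hAL : ∀ α, A α ⊆ L := by
    intro α
    induction α using WellFoundedLT.induction with
    | ind α ih =>
      rw [hA]
      refine (hG ?_).trans hGL
      rintro u ⟨β, hβ, hu⟩
      exact ih β hβ hu
  set r : U → Ordinal.{uu} := fun u => sInf {α | u ∈ A α} with hr
  have hrle : ∀ u α, u ∈ A α → r u ≤ α := fun u α h => csInf_le' h
  have hLA : ∀ u ∈ L, ∃ α, u ∈ A α := by
    intro u hu
    rw [hL] at hu
    refine hu {u | ∃ α, u ∈ A α} ?_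
    intro v hv
    obtain ⟨γ, hγ⟩ : ∃ γ, ∀ u, r u < γ := by
      refine ⟨Order.succ (⨆ u, r u), fun u => Order.lt_succ_of_le ?_⟩
      exact le_ciSup (Ordinal.bddAbove_of_small) u
    refine ⟨γ, ?_⟩
    rw [hA]
    refine hG ?_ hv
    rintro w ⟨α, hw⟩
    exact ⟨r w, hγ w, csInf_mem (s := {α | w ∈ A α}) ⟨α, hw⟩⟩
  have hmem : ∀ u ∈ L, u ∈ A (r u) := fun u hu =>
    csInf_mem (s := {α | u ∈ A α}) (hLA u hu)
  have hB : ∀ α, A α = G {w | w ∈ L ∧ r w < α} := by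
    intro α
    rw [hA]
    congr 1
    ext w
    constructor
    · rintro ⟨β, hβ, hw⟩
      exact ⟨hAL β hw, (hrle w β hw).trans_lt hβ⟩
    · rintro ⟨hw, h⟩
      exact ⟨r w, h, hmem w hw⟩
  refine ⟨r, fun u hu => ?_, fun α v hv => ?_⟩
  · rw [← hB]; exact hmem u hu
  · rw [← hB] at hv
    exact ⟨hAL _ hv, hrle _ _ hv⟩

theorem core {U : Type uu} {k : ℕ} (P : ℕ → Prop) (f : (Fin k → Set U) → Set U)
    (hf : ∀ X Y : Fin k → Set U, (∀ i, X i ⊆ Y i) → f X ⊆ f Y) (i : ℕ) :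
    ∀ X : Fin k → Set U, ∃ ρ : U → ℕ → Ordinal.{uu}, (∀ u c, i ≤ c → ρ u c = 0) ∧
      ∀ u ∈ gSem P f i X, u ∈ f (fun j => {v | ((j : ℕ) < i → v ∈ gSem P f i X ∧
        DecR P j (ρ v) (ρ u)) ∧ (¬ (j : ℕ) < i → v ∈ X j)}) := by
  classical
  induction i with
  | zero =>
    intro X
    refine ⟨fun _ _ => 0, fun _ _ _ => rfl, fun u hu => ?_⟩
    simpa [gSem] using hu
  | succ i ih =>
    intro X
    have hG : Monotone (fun Y : Set U =>
        gSem P f i (fun j => if (j : ℕ) = i then Y else X j)) := by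
      intro Y Y' h
      apply gSem_mono P f hf
      intro j
      by_cases hj : (j : ℕ) = i
      · simpa [hj] using h
      · simp [hj]
    by_cases hP : P i
    · obtain ⟨r, hr1, hr2⟩ := lfp_rank _ hG _ (gSem_mu f hP X)
      set L := gSem P f (i+1) X
      choose ρ hρ0 hρ using fun α : Ordinal.{uu} =>
        ih (fun j => if (j : ℕ) = i then {w | w ∈ L ∧ r w < α} else X j)
      refine ⟨fun u => Function.update (ρ (r u) u) i (r u), ?_, ?_⟩
      · intro u c hc
        beta_reduce
        rw [Function.update_of_ne (by omega)]
        exact hρ0 _ _ _ (by omega)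
      · beta_reduce
        intro u hu
        refine hf _ _ ?_ (hρ (r u) u (hr1 u hu))
        rintro j v ⟨hv1, hv2⟩
        refine ⟨fun hj => ?_, fun hj => ?_⟩
        · by_cases hji : (j : ℕ) < i
          · obtain ⟨hvG, hD⟩ := hv1 hji
            obtain ⟨hvL, hvr⟩ := hr2 _ _ hvG
            refine ⟨hvL, ?_⟩
            rcases hvr.lt_or_eq with hlt | heq
            · refine Or.inl ⟨i, hji.le, by simpa using hlt, fun c' hc' => ?_⟩
              rw [Function.update_of_ne (by omega), Function.update_of_ne (by omega),
                hρ0 _ _ _ hc'.le, hρ0 _ _ _ hc'.le]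
            · rw [heq]
              rcases hD with ⟨c, hc, hlt, hab⟩ | ⟨hnP, hab⟩
              · have hci : c < i := by
                  by_contra hci
                  rw [hρ0 _ _ _ (not_lt.1 hci), hρ0 _ _ _ (not_lt.1 hci)] at hlt
                  exact lt_irrefl _ hlt
                refine Or.inl ⟨c, hc, ?_, fun c' hc' => ?_⟩
                · rw [Function.update_of_ne hci.ne, Function.update_of_ne hci.ne]
                  exact hlt
                · by_cases h : c' = i
                  · subst h; simp
                  · rw [Function.update_of_ne h, Function.update_of_ne h]
                    exact hab c' hc'
              · refine Or.inr ⟨hnP, fun c' hc' => ?_⟩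
                by_cases h : c' = i
                · subst h; simp
                · rw [Function.update_of_ne h, Function.update_of_ne h]
                  exact hab c' hc'
          · have hji' : (j : ℕ) = i := by omega
            have := hv2 hji
            rw [if_pos hji'] at this
            refine ⟨this.1, Or.inl ⟨i, hji'.le, by simpa using this.2, fun c' hc' => ?_⟩⟩
            rw [Function.update_of_ne (by omega), Function.update_of_ne (by omega),
                hρ0 _ _ _ hc'.le, hρ0 _ _ _ hc'.le]
        · have := hv2 (by omega)
          rwa [if_neg (by omega)] at this
    · have hL := gSem_nu f hP X
      set L := gSem P f (i+1) X
      have h1 : L ⊆ gSem P f i (fun j => if (j : ℕ) = i then L else X j) := by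
        intro u hu
        rw [hL] at hu
        obtain ⟨Y, hY, hu⟩ := hu
        refine hG ?_ (hY hu)
        rw [hL]
        intro w hw
        exact ⟨Y, hY, hw⟩
      have h2 : gSem P f i (fun j => if (j : ℕ) = i then L else X j) ⊆ L := by
        intro u hu
        rw [hL]
        exact ⟨_, hG h1, hu⟩
      obtain ⟨ρ, hρ0, hρ⟩ := ih (fun j => if (j : ℕ) = i then L else X j)
      refine ⟨ρ, fun u c hc => hρ0 u c (by omega), fun u hu => ?_⟩
      refine hf _ _ ?_ (hρ u (h1 hu))
      rintro j v ⟨hv1, hv2⟩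
      refine ⟨fun hj => ?_, fun hj => ?_⟩
      · by_cases hji : (j : ℕ) < i
        · exact ⟨h2 (hv1 hji).1, (hv1 hji).2⟩
        · have hji' : (j : ℕ) = i := by omega
          have := hv2 hji
          rw [if_pos hji'] at this
          refine ⟨this, Or.inr ⟨by rwa [hji'], fun c hc => ?_⟩⟩
          rw [hρ0 _ _ (by omega), hρ0 _ _ (by omega)]
      · have := hv2 (by omega)
        rwa [if_neg (by omega)] at this

theorem ev_const (a : ℕ → Ordinal.{uu}) (N : ℕ) (h : ∀ n, N ≤ n → a (n+1) ≤ a n) :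
    ∃ M, N ≤ M ∧ ∀ n, M ≤ n → a n = a M := by
  have hne : (a '' Set.Ici N).Nonempty := ⟨a N, N, Set.mem_Ici.2 (le_refl N), rfl⟩
  obtain ⟨M, hM, hMe⟩ := csInf_mem hne
  refine ⟨M, hM, fun n hn => le_antisymm ?_ ?_⟩
  · induction n, hn using Nat.le_induction with
    | base => exact le_refl _
    | succ n hn ih => exact (h n (le_trans hM hn)).trans ih
  · rw [hMe]
    exact csInf_le' ⟨n, le_trans hM hn, rfl⟩

theorem no_mu (P : ℕ → Prop) (k : ℕ) (r : ℕ → ℕ → Ordinal.{uu}) (j : ℕ → ℕ)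
    (h0 : ∀ n c, k ≤ c → r n c = 0) (hD : ∀ n, DecR P (j n) (r (n+1)) (r n)) (m : ℕ)
    (hfr : ∃ᶠ n in atTop, j n = m) (hev : ∀ᶠ n in atTop, j n ≤ m) : ¬ P m := by
  intro hP
  obtain ⟨N, hN⟩ := eventually_atTop.1 hev
  have key : ∀ d c, m ≤ c → k ≤ c + d → ∃ M, N ≤ M ∧ ∀ c', c ≤ c' → ∀ n, M ≤ n →
      r (n+1) c' = r n c' := by
    intro d
    induction d with
    | zero =>
      intro c hc hk
      exact ⟨N, le_refl _, fun c' hc' n hn => by rw [h0 _ _ (by omega), h0 _ _ (by omega)]⟩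
    | succ d ih =>
      intro c hc hk
      obtain ⟨M, hM, hMc⟩ := ih (c+1) (by omega) (by omega)
      obtain ⟨M', hM', hc'⟩ := ev_const (fun n => r n c) M (by
        intro n hn
        rcases hD n with ⟨e, he, hlt, hab⟩ | ⟨_, hab⟩
        · rcases lt_trichotomy e c with h | h | h
          · exact (hab c h).le
          · subst h; exact hlt.le
          · exact absurd (hMc e h n hn) hlt.ne
        · exact (hab c ((hN n (hM.trans hn)).trans hc)).le)
      refine ⟨M', hM.trans hM', fun e he n hn => ?_⟩
      rcases Nat.eq_or_lt_of_le he with h | h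
      · subst h
        exact (hc' (n+1) (by omega)).trans (hc' n hn).symm
      · exact hMc e h n (hM'.trans hn)
  obtain ⟨M, hM, hMc⟩ := key k m (le_refl _) (by omega)
  obtain ⟨n, hn, hj⟩ := frequently_atTop.1 hfr M
  rcases hD n with ⟨e, he, hlt, hab⟩ | ⟨hn', _⟩
  · exact hlt.ne (hMc e (by omega) n hn)
  · rw [hj] at hn'; exact hn' hP

theorem exists_max_s1 (k : ℕ) (j : ℕ → ℕ) (hj : ∀ n, j n < k) :
    ∃ m, (∃ᶠ n in atTop, j n = m) ∧ ∀ᶠ n in atTop, j n ≤ m := by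
  induction k with
  | zero => exact absurd (hj 0) (by omega)
  | succ k _ =>
    clear * - hj
    classical
    have hex : ∃ m, ∀ᶠ n in atTop, j n ≤ m :=
      ⟨k, Eventually.of_forall fun n => by have := hj n; omega⟩
    refine ⟨Nat.find hex, ?_, Nat.find_spec hex⟩
    intro hne
    have h1 := Nat.find_spec hex
    rcases Nat.eq_zero_or_pos (Nat.find hex) with h | h
    · obtain ⟨n, hn1, hn2⟩ := (h1.and hne).exists
      omega
    · refine Nat.find_min hex (m := Nat.find hex - 1) (by omega) ?_
      filter_upwards [h1, hne] with n hn1 hn2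
      omega

theorem play_parity {U : Type uu} {k : ℕ} (P : ℕ → Prop) (ρ : U → ℕ → Ordinal.{uu})
    (h0 : ∀ u c, k ≤ c → ρ u c = 0) (π : ℕ → FPGameNode U k)
    (h : ∀ n, ∃ u X w, ∃ j : Fin k, π (3*n) = Sum.inl u ∧ π (3*n+1) = Sum.inr (Sum.inl X) ∧
      π (3*n+2) = Sum.inr (Sum.inr (w, j)) ∧ π (3*n+3) = Sum.inl w ∧ DecR P j (ρ w) (ρ u)) :
    ∃ m, ¬ P m ∧ (∃ᶠ i in atTop, fgPrio (π i) = m+1) ∧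
      ∀ q, q > m + 1 → ∀ᶠ i in atTop, fgPrio (π i) ≠ q := by
  choose u X w j h1 h2 h3 h4 hD using h
  have hw : ∀ n, w n = u (n+1) := by
    intro n
    have := h4 n
    rw [show 3*n+3 = 3*(n+1) by ring, h1] at this
    exact (Sum.inl.inj this).symm
  obtain ⟨m, hfr, hev⟩ := exists_max_s1 k (fun n => (j n : ℕ)) (fun n => (j n).2)
  refine ⟨m, no_mu P k (fun n => ρ (u n)) (fun n => (j n : ℕ)) (fun n => h0 _)
    (fun n => by have := hD n; rwa [hw] at this) m hfr hev, ?_, ?_⟩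
  · rw [frequently_atTop] at hfr ⊢
    intro N
    obtain ⟨n, hn, hj⟩ := hfr N
    refine ⟨3*n+2, by omega, ?_⟩
    rw [h3]
    simpa [fgPrio] using hj
  · intro q hq
    obtain ⟨N, hN⟩ := eventually_atTop.1 hev
    refine eventually_atTop.2 ⟨3*N, fun i hi => ?_⟩
    obtain ⟨n, hn⟩ : ∃ n, i = 3*n ∨ i = 3*n+1 ∨ i = 3*n+2 := ⟨i/3, by omega⟩
    rcases hn with rfl | rfl | rfl
    · rw [h1]; simp only [fgPrio]; omega
    · rw [h2]; simp only [fgPrio]; omega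
    · rw [h3]; simp only [fgPrio]
      have := hN n (by omega)
      omega

theorem dir1 {U : Type uu} {k : ℕ} (P : ℕ → Prop) (hPe : ∀ m, ¬ P m → Even (m+1))
    (f : (Fin k → Set U) → Set U)
    (hf : ∀ X Y : Fin k → Set U, (∀ i, X i ⊆ Y i) → f X ⊆ f Y) (u : U) (X₀ : Fin k → Set U)
    (hu : u ∈ gSem P f k X₀) :
    WinsFrom (fgVex U k) (fgE f) (ParityWinsPlay fgPrio) (Sum.inl u) := by
  classical
  obtain ⟨ρ, h0, hρ⟩ := core P f hf k X₀
  set F := gSem P f k X₀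
  let Z : U → Fin k → Set U := fun u j => {v | v ∈ F ∧ DecR P j (ρ v) (ρ u)}
  have hZ : ∀ u ∈ F, u ∈ f (Z u) := by
    intro u hu
    refine hf _ _ ?_ (hρ u hu)
    rintro j v ⟨hv, _⟩
    exact hv j.2
  let σ : List (FPGameNode U k) → FPGameNode U k → FPGameNode U k := fun _ s =>
    if h : ∃ u ∈ F, s = Sum.inl u then Sum.inr (Sum.inl (Z h.choose))
    else if h : (fgE f s).Nonempty then h.some else s
  have hσ : ∀ h, ∀ u ∈ F, σ h (Sum.inl u) = Sum.inr (Sum.inl (Z u)) := by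
    intro h u hu
    have hex : ∃ u' ∈ F, (Sum.inl u : FPGameNode U k) = Sum.inl u' := ⟨u, hu, rfl⟩
    have := hex.choose_spec.2
    simp only [σ, dif_pos hex]
    rw [← Sum.inl.inj this]
  refine ⟨σ, ?_, ?_, ?_⟩
  · rintro h s - hne
    by_cases hs : ∃ u ∈ F, s = Sum.inl u
    · obtain ⟨v, hv, rfl⟩ := hs
      rw [hσ h v hv]
      exact ⟨Z v, rfl, hZ v hv⟩
    · simp only [σ, dif_neg hs, dif_pos hne]
      exact hne.some_mem
  · intro p n hp0 hE hc hV
    have inv : ∀ i, i ≤ n → (∀ v, p i = Sum.inl v → v ∈ F) ∧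
        (∀ X, p i = Sum.inr (Sum.inl X) → ∀ j, X j ⊆ F) ∧
        (∀ w j, p i = Sum.inr (Sum.inr (w, j)) → w ∈ F) := by
      intro i
      induction i with
      | zero =>
        intro _
        rw [hp0]
        refine ⟨fun v hv => ?_, fun X hX => ?_, fun w j hw => ?_⟩
        · cases hv; exact hu
        · cases hX
        · cases hw
      | succ i ih =>
        intro hi
        obtain ⟨i1, i2, i3⟩ := ih (by omega)
        have hE' := hE i (by omega)
        have hc' := hc i (by omega)
        rcases hpi : p i with v | X | ⟨w, j⟩
        · have := hc' ⟨v, hpi⟩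
          rw [hpi, hσ (histList p i) v (i1 v hpi)] at this
          rw [this]
          refine ⟨fun v hv => ?_, fun X hX => ?_, fun w j hw => ?_⟩
          · cases hv
          · cases hX; intro j x hx; exact hx.1
          · cases hw
        · rw [hpi] at hE'
          obtain ⟨w, j, he, hw⟩ := hE'
          rw [he]
          refine ⟨fun v hv => ?_, fun X hX => ?_, fun w j hw' => ?_⟩
          · cases hv
          · cases hX
          · cases hw'; exact i2 X hpi _ hw
        · rw [hpi] at hE'
          have he : p (i+1) = Sum.inl w := hE'
          rw [he]
          refine ⟨fun v hv => ?_, fun X hX => ?_, fun w j hw' => ?_⟩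
          · cases hv; exact i3 _ _ hpi
          · cases hX
          · cases hw'
    obtain ⟨v, hv⟩ := hV
    have hvF := (inv n le_rfl).1 v hv
    rw [hv]
    exact ⟨_, Z v, rfl, hZ v hvF⟩
  · intro π hπ0 hE hc
    have step : ∀ n, ∀ v ∈ F, π n = Sum.inl v → ∃ w, ∃ j : Fin k,
        π (n+1) = Sum.inr (Sum.inl (Z v)) ∧ π (n+2) = Sum.inr (Sum.inr (w, j)) ∧
        π (n+3) = Sum.inl w ∧ w ∈ Z v j := by
      intro n v hv hn
      have a1 : π (n+1) = Sum.inr (Sum.inl (Z v)) := by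
        have := hc n ⟨v, hn⟩
        rwa [hn, hσ (histList π n) v hv] at this
      have a2 := hE (n+1)
      rw [a1] at a2
      obtain ⟨w, j, a2, hw⟩ := a2
      have a3 := hE (n+2)
      rw [a2] at a3
      exact ⟨w, j, a1, a2, a3, hw⟩
    have inv : ∀ n, ∃ v ∈ F, π (3*n) = Sum.inl v := by
      intro n
      induction n with
      | zero => exact ⟨u, hu, hπ0⟩
      | succ n ih =>
        obtain ⟨v, hv, hn⟩ := ih
        obtain ⟨w, j, _, _, a3, hw⟩ := step _ v hv hn
        exact ⟨w, hw.1, a3⟩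
    obtain ⟨m, hm, h1, h2⟩ := play_parity P ρ h0 π (by
      intro n
      obtain ⟨v, hv, hn⟩ := inv n
      obtain ⟨w, j, a1, a2, a3, hw⟩ := step _ v hv hn
      exact ⟨v, Z v, w, j, hn, a1, a2, a3, hw.2⟩)
    exact ⟨m+1, hPe m hm, h1, h2⟩

theorem histList_succ {V : Type*} (p : ℕ → V) (n : ℕ) :
    histList p (n+1) = histList p n ++ [p n] := by
  simp only [histList]
  rw [List.ofFn_succ_last]
  simp

theorem dir2 {U : Type uu} {k : ℕ} (P : ℕ → Prop) (hPo : ∀ m, P m → ¬ Even (m+1))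
    (f : (Fin k → Set U) → Set U)
    (hf : ∀ X Y : Fin k → Set U, (∀ i, X i ⊆ Y i) → f X ⊆ f Y) (u : U) (X₀ : Fin k → Set U)
    (hw : WinsFrom (fgVex U k) (fgE f) (ParityWinsPlay fgPrio) (Sum.inl u)) :
    u ∈ gSem P f k X₀ := by
  classical
  by_contra hu
  obtain ⟨σ, hσ1, hσ2, hσ3⟩ := hw
  change u ∈ (gSem P f k X₀)ᶜ at hu
  rw [gSem_dual] at hu
  obtain ⟨ρ, h0, hρ⟩ := core (fun i => ¬ P i) (fun Z => (f (fun j => (Z j)ᶜ))ᶜ) (by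
    intro X Y h
    exact Set.compl_subset_compl.2 (hf _ _ fun i => Set.compl_subset_compl.2 (h i))) k
      (fun j => (X₀ j)ᶜ)
  set F := gSem (fun i => ¬ P i) (fun Z => (f (fun j => (Z j)ᶜ))ᶜ) k (fun j => (X₀ j)ᶜ)
  have hch : ∀ (v : U) (X : Fin k → Set U), v ∈ F ∧ v ∈ f X → ∃ q : U × Fin k,
      q.1 ∈ X q.2 ∧ q.1 ∈ F ∧ DecR (fun i => ¬ P i) q.2 (ρ q.1) (ρ v) := by
    rintro v X ⟨hv, hvX⟩
    by_contra hcon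
    push Not at hcon
    refine hρ v hv (hf _ _ ?_ hvX)
    rintro j x hx ⟨hx', _⟩
    exact hcon (x, j) hx (hx' j.2).1 (hx' j.2).2
  let nx : List (FPGameNode U k) → FPGameNode U k → U → FPGameNode U k := fun h s v =>
    match s with
    | Sum.inl u => σ h (Sum.inl u)
    | Sum.inr (Sum.inl X) => if hh : v ∈ F ∧ v ∈ f X then Sum.inr (Sum.inr (hch v X hh).choose)
        else s
    | Sum.inr (Sum.inr (w, _)) => Sum.inl w
  let lst : FPGameNode U k → U → U := fun s v =>
    match s with
    | Sum.inl u => u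
    | _ => v
  let st : ℕ → List (FPGameNode U k) × FPGameNode U k × U := fun n =>
    Nat.rec ([], Sum.inl u, u) (fun _ q => (q.1 ++ [q.2.1], nx q.1 q.2.1 q.2.2, lst q.2.1 q.2.2)) n
  have st_succ : ∀ n, st (n+1) = ((st n).1 ++ [(st n).2.1], nx (st n).1 (st n).2.1 (st n).2.2,
      lst (st n).2.1 (st n).2.2) := fun n => rfl
  let π : ℕ → FPGameNode U k := fun n => (st n).2.1
  have hhist : ∀ n, (st n).1 = histList π n := by
    intro n
    induction n with
    | zero => simp [st, histList]
    | succ n ih => rw [histList_succ, ← ih, st_succ]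
  have hπ : ∀ n, π (n+1) = nx (histList π n) (π n) (st n).2.2 := by
    intro n
    rw [← hhist]
  have hl : ∀ n, (st (n+1)).2.2 = lst (π n) (st n).2.2 := fun n => rfl
  have hcomp : ∀ i, π i ∈ fgVex U k → π (i+1) = σ (histList π i) (π i) := by
    rintro i ⟨v, hv⟩
    rw [hπ, hv]
  have hstep : ∀ n v, (∀ i, i < 3*n → π (i+1) ∈ fgE f (π i)) → v ∈ F → π (3*n) = Sum.inl v →
      ∃ X w, ∃ j : Fin k, v ∈ f X ∧ w ∈ X j ∧ π (3*n+1) = Sum.inr (Sum.inl X) ∧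
      π (3*n+2) = Sum.inr (Sum.inr (w, j)) ∧ π (3*n+3) = Sum.inl w ∧ w ∈ F ∧
      DecR (fun i => ¬ P i) j (ρ w) (ρ v) := by
    intro n v hE hv hn
    have hne := hσ2 π (3*n) rfl hE (fun i _ => hcomp i) ⟨v, hn⟩
    have h1 := hσ1 (histList π (3*n)) (π (3*n)) ⟨v, hn⟩ hne
    rw [← hcomp _ ⟨v, hn⟩, hn] at h1
    obtain ⟨X, hX, hvX⟩ := h1
    have hl1 : (st (3*n+1)).2.2 = v := by rw [hl, hn]
    obtain ⟨c1, c2, c3⟩ := (hch v X ⟨hv, hvX⟩).choose_spec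
    have h2 : π (3*n+1+1) = Sum.inr (Sum.inr (hch v X ⟨hv, hvX⟩).choose) := by
      rw [hπ (3*n+1), hX, hl1]
      simp only [nx]
      rw [dif_pos ⟨hv, hvX⟩]
    have h3 : π (3*n+2+1) = Sum.inl (hch v X ⟨hv, hvX⟩).choose.1 := by
      rw [hπ (3*n+2), h2]
    exact ⟨X, _, _, hvX, c1, hX, h2, h3, c2, c3⟩
  have inv : ∀ n, (∀ i, i < 3*n → π (i+1) ∈ fgE f (π i)) ∧ ∃ v ∈ F, π (3*n) = Sum.inl v := by
    intro n
    induction n with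
    | zero => exact ⟨fun i hi => absurd hi (by omega), u, hu, rfl⟩
    | succ n ih =>
      obtain ⟨hE, v, hv, hn⟩ := ih
      obtain ⟨X, w, j, hvX, hwX, a1, a2, a3, hwF, _⟩ := hstep n v hE hv hn
      refine ⟨fun i hi => ?_, w, hwF, a3⟩
      rcases (by omega : i < 3*n ∨ i = 3*n ∨ i = 3*n+1 ∨ i = 3*n+2) with h | rfl | rfl | rfl
      · exact hE i h
      · rw [a1, hn]; exact ⟨X, rfl, hvX⟩
      · rw [a2, a1]; exact ⟨w, j, rfl, hwX⟩
      · rw [a3, a2]; rfl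
  have hwin := hσ3 π rfl (fun i => (inv (i+1)).1 i (by omega)) hcomp
  obtain ⟨m, hm, h1, h2⟩ := play_parity (fun i => ¬ P i) ρ h0 π (by
    intro n
    obtain ⟨hE, v, hv, hn⟩ := inv n
    obtain ⟨X, w, j, hvX, hwX, a1, a2, a3, hwF, hD⟩ := hstep n v hE hv hn
    exact ⟨v, X, w, j, hn, a1, a2, a3, hD⟩)
  obtain ⟨m', hm', h1', h2'⟩ := hwin
  have hmm : m' = m + 1 := by
    rcases lt_trichotomy m' (m+1) with h | h | h
    · exact absurd (h2' _ h) h1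
    · exact h
    · exact absurd (h2 _ h) h1'
  subst hmm
  exact hPo m (not_not.1 hm) hm'

/-- Characterization of nested fixpoints by fixpoint games (Baldan et al.):
`u ∈ e` iff player ∃ wins the fixpoint game `G_e` from node `u`. -/
theorem statement1 {U : Type*} {k : ℕ} (hk : Even k)
    (f : (Fin k → Set U) → Set U)
    (hf : ∀ X Y : Fin k → Set U, (∀ i, X i ⊆ Y i) → f X ⊆ f Y) (u : U) :
    u ∈ fpSem f k (fun _ => ∅) ↔
      WinsFrom (fgVex U k) (fgE f) (ParityWinsPlay fgPrio) (Sum.inl u) := by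
  rw [fpSem_eq_gSem]
  constructor
  · exact dir1 _ (fun m hm => by rw [Nat.even_iff]; omega) f hf u _
  · exact dir2 _ (fun m hm => by rw [Nat.even_iff]; omega) f hf u _
end

section
/- Let G=(V_∃,V_∀,E,Ω) be a parity game with priorities {1,…,k}, k even, let W be a positional DAG in G, V'=V∖W, and let d=νX_k.μX_{k-1}.….μX_1.DAttr_W(X_1,…,X_k) be the nested fixpoint over subsets of V'. Then every node v∈V' with v∈d is won by player ∃ in G, i.e. d ⊆ Win_G; moreover player ∃ has a positional winning strategy in G from every node of d. -/
open Filter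

/-- Player ∃ has a positional winning strategy from `v`. -/
def PosWinsFrom {V : Type*} (Vex : Set V) (E : V → Set V) (WinPlay : (ℕ → V) → Prop)
    (v : V) : Prop :=
  ∃ σ : V → V,
    (∀ u : V, u ∈ Vex → (E u).Nonempty → σ u ∈ E u) ∧
    (∀ (p : ℕ → V) (n : ℕ), p 0 = v → (∀ i, i < n → p (i+1) ∈ E (p i)) →
        (∀ i, i < n → p i ∈ Vex → p (i+1) = σ (p i)) →
        p n ∈ Vex → (E (p n)).Nonempty) ∧
    (∀ π : ℕ → V, π 0 = v → (∀ i, π (i+1) ∈ E (π i)) →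
        (∀ i, π i ∈ Vex → π (i+1) = σ (π i)) → WinPlay π)

/-- A set `W` of nodes is a DAG if it contains no `E`-cycle. -/
def IsDAG {V : Type*} (E : V → Set V) (W : Set V) : Prop :=
  ¬ ∃ (p : ℕ → V) (n : ℕ), 1 ≤ n ∧ p n = p 0 ∧ (∀ i, i ≤ n → p i ∈ W) ∧
      ∀ i, i < n → p (i+1) ∈ E (p i)

/-- `w` is reachable from `v` without visiting any real node other than `v`
(all nodes after `v` up to and including `w` lie in the DAG `W`). -/
def ReachThroughDAG {V : Type*} (E : V → Set V) (W : Set V) (v w : V) : Prop :=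
  ∃ (p : ℕ → V) (n : ℕ), p 0 = v ∧ p n = w ∧ (∀ i, i < n → p (i+1) ∈ E (p i)) ∧
      ∀ i, 1 ≤ i → i ≤ n → p i ∈ W

/-- A DAG `W` is positional if for each node `w ∈ W` owned by player ∃ there is exactly one
real node `v ∉ W` from which `w` is reachable without visiting any other real node. -/
def IsPositionalDAG {V : Type*} (Vex : Set V) (E : V → Set V) (W : Set V) : Prop :=
  IsDAG E W ∧ ∀ w, w ∈ W ∩ Vex → ∃! v, v ∉ W ∧ ReachThroughDAG E W v w

/-- Player ∃ can attract to the tuple `Vbar` from `v` within the DAG `W`: there is a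
positional strategy `σ` such that for every `σ`-compatible play `π` from `v`, the first
node `v' ≠ v` of `π` lying in the set of real nodes belongs to `Vbar p` (1-based: the
coordinate `j` with `j+1 = p`), where `p` is the maximal priority visited by the segment
of `π` leading from `v` to `v'`. -/
def Attracts {V : Type*} (Vex : Set V) (E : V → Set V) (Ω : V → ℕ) (W : Set V) {k : ℕ}
    (Vbar : Fin k → Set V) (v : V) : Prop :=
  ∃ σ : V → V, (∀ u : V, u ∈ Vex → (E u).Nonempty → σ u ∈ E u) ∧
    ∀ π : ℕ → V, π 0 = v → (∀ i, π (i+1) ∈ E (π i)) →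
      (∀ i, π i ∈ Vex → π (i+1) = σ (π i)) →
      ∃ n, 1 ≤ n ∧ π n ∉ W ∧ π n ≠ v ∧
        (∀ i, 1 ≤ i → i < n → (π i ∈ W ∨ π i = v)) ∧
        ∃ j : Fin k, (j : ℕ) + 1 = (Finset.range (n+1)).sup (fun i => Ω (π i)) ∧
          π n ∈ Vbar j

/-- The DAG attractor function `DAttr_W : 𝒫(V')^k → 𝒫(V')`, where `V' = V ∖ W` is the set
of real nodes (represented as the subtype of the complement of `W`). -/
def DAttr {V : Type*} (Vex : Set V) (E : V → Set V) (Ω : V → ℕ) (W : Set V) {k : ℕ}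
    (Vbar : Fin k → Set (Wᶜ : Set V)) : Set (Wᶜ : Set V) :=
  {v : (Wᶜ : Set V) | Attracts Vex E Ω W (fun j => Subtype.val '' (Vbar j)) (v : V)}



universe u

theorem ps_rank {U : Type u} (g : Set U → Set U) (hg : ∀ A B, A ⊆ B → g A ⊆ g B)
    (D : Set U) (hD : D = ⋂₀ {Y | g Y ⊆ Y}) :
    ∃ r : U → Ordinal.{u}, (∀ x, x ∈ D → x ∈ g {y | y ∈ D ∧ r y < r x}) ∧
      ∀ a x, x ∈ g {y | y ∈ D ∧ r y < a} → r x ≤ a := by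
  classical
  let A : Ordinal.{u} → Set U := WellFounded.fix (C := fun _ => Set U) Ordinal.lt_wf
    (fun a ih => g {y | ∃ b, ∃ h : b < a, y ∈ ih b h})
  have hA : ∀ a, A a = g {y | ∃ b, b < a ∧ y ∈ A b} := by
    intro a
    have := WellFounded.fix_eq (C := fun _ => Set U) Ordinal.lt_wf
      (fun a ih => g {y | ∃ b, ∃ h : b < a, y ∈ ih b h}) a
    refine this.trans ?_
    congr 1
    ext y
    simp only [Set.mem_ofPred_eq, exists_prop]
    rfl
  let r : U → Ordinal.{u} := fun x => sInf {a | x ∈ A a}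
  have hr1 : ∀ x a, x ∈ A a → r x ≤ a := fun x a h => csInf_le' h
  have hr2 : ∀ x a, x ∈ A a → x ∈ A (r x) := fun x a h =>
    csInf_mem (s := {a | x ∈ A a}) ⟨a, h⟩
  have hgD : g D ⊆ D := by
    intro x hx
    rw [hD]
    intro Y hY
    exact hY (hg D Y (by rw [hD]; exact Set.sInter_subset_of_mem hY) hx)
  have hAD : ∀ a, A a ⊆ D := by
    intro a
    induction a using WellFoundedLT.induction with
    | ind a ih =>
      rw [hA]
      refine (hg _ _ ?_).trans hgD
      rintro y ⟨b, hb, hy⟩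
      exact ih b hb hy
  let s : Ordinal.{u} := ⨆ x : U, Order.succ (r x)
  have hs : ∀ x, r x < s := fun x =>
    lt_of_lt_of_le (Order.lt_succ (r x)) (Ordinal.le_iSup (fun x : U => Order.succ (r x)) x)
  have hDA : ∀ x ∈ D, ∃ a, x ∈ A a := by
    intro x hx
    rw [hD] at hx
    refine hx {x | ∃ a, x ∈ A a} ?_
    intro y hy
    refine ⟨s, ?_⟩
    rw [hA]
    refine hg _ _ ?_ hy
    rintro z ⟨a, hz⟩
    exact ⟨r z, hs z, hr2 z a hz⟩
  refine ⟨r, fun x hx => ?_, fun a x hx => hr1 x a ?_⟩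
  rotate_left
  · rw [hA]
    refine hg _ _ ?_ hx
    rintro y ⟨hy, hya⟩
    obtain ⟨b, hb⟩ := hDA y hy
    exact ⟨r y, hya, hr2 y b hb⟩
  obtain ⟨a, ha⟩ := hDA x hx
  have h := hr2 x a ha
  rw [hA] at h
  refine hg _ _ ?_ h
  rintro y ⟨b, hb, hy⟩
  exact ⟨hAD b hy, lt_of_le_of_lt (hr1 y b hy) hb⟩

def PsGood {U : Type*} (i : ℕ) (R : ℕ → U → U → Prop) : Prop :=
  ∀ (x : ℕ → U) (p : ℕ → ℕ), (∀ n, p n < i) → (∀ n, R (p n) (x n) (x (n+1))) →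
    ∃ m, Odd m ∧ (∃ᶠ n in atTop, p n = m) ∧ ∀ᶠ n in atTop, p n ≤ m

theorem PsGood.tail {U : Type*} {i : ℕ} {R : ℕ → U → U → Prop} (h : PsGood i R)
    (x : ℕ → U) (p : ℕ → ℕ) (N : ℕ) (h1 : ∀ n, N ≤ n → p n < i)
    (h2 : ∀ n, N ≤ n → R (p n) (x n) (x (n+1))) :
    ∃ m, Odd m ∧ (∃ᶠ n in atTop, p n = m) ∧ ∀ᶠ n in atTop, p n ≤ m := by
  obtain ⟨m, hm, hf, he⟩ := h (fun n => x (n + N)) (fun n => p (n + N))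
    (fun n => h1 _ (by omega)) (fun n => by
      have := h2 (n + N) (by omega)
      rwa [show n + N + 1 = n + 1 + N by omega] at this)
  refine ⟨m, hm, ?_, ?_⟩
  · rw [frequently_atTop] at hf ⊢
    intro a
    obtain ⟨b, hb, hb'⟩ := hf a
    exact ⟨b + N, by omega, hb'⟩
  · rw [eventually_atTop] at he ⊢
    obtain ⟨a, ha⟩ := he
    refine ⟨a + N, fun b hb => ?_⟩
    have := ha (b - N) (by omega)
    rwa [show b - N + N = b by omega] at this

theorem ps_mono {U : Type*} {k : ℕ} (f : (Fin k → Set U) → Set U)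
    (hf : ∀ X Y : Fin k → Set U, (∀ j, X j ⊆ Y j) → f X ⊆ f Y) :
    ∀ i (X Y : Fin k → Set U), (∀ j, X j ⊆ Y j) → fpSem f i X ⊆ fpSem f i Y := by
  intro i
  induction i with
  | zero => exact hf
  | succ i ih =>
    intro X Y h
    have key : ∀ Z : Set U, fpSem f i (fun j => if (j : ℕ) = i then Z else X j) ⊆
        fpSem f i (fun j => if (j : ℕ) = i then Z else Y j) := by
      intro Z
      apply ih
      intro j
      try dsimp only
      split_ifs
      · exact subset_rfl
      · exact h j
    simp only [fpSem]
    split_ifs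
    · intro x hx Z hZ
      exact hx Z ((key Z).trans hZ)
    · rintro x ⟨Z, hZ, hx⟩
      exact ⟨Z, Set.Subset.trans hZ (key Z), hx⟩

theorem ps_main {U : Type u} {k : ℕ} (f : (Fin k → Set U) → Set U)
    (hf : ∀ X Y : Fin k → Set U, (∀ j, X j ⊆ Y j) → f X ⊆ f Y) :
    ∀ i (X : Fin k → Set U), ∃ R : ℕ → U → U → Prop, PsGood i R ∧
      ∀ x ∈ fpSem f i X,
        x ∈ f (fun j => if (j : ℕ) < i then {y | y ∈ fpSem f i X ∧ R j x y} else X j) := by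
  intro i
  induction i with
  | zero =>
    intro X
    refine ⟨fun _ _ _ => True, fun x p h => absurd (h 0) (by omega), fun x hx => ?_⟩
    simpa [fpSem] using hx
  | succ i ih =>
    intro X
    let g : Set U → Set U := fun Y => fpSem f i (fun j => if (j : ℕ) = i then Y else X j)
    have hg : ∀ A B, A ⊆ B → g A ⊆ g B := by
      intro A B h
      apply ps_mono f hf
      intro j
      try dsimp only
      split_ifs
      · exact h
      · exact subset_rfl
    by_cases hi : (i + 1) % 2 = 1
    · have hD : fpSem f (i+1) X = ⋂₀ {Y | g Y ⊆ Y} := by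
        simp only [fpSem, hi, if_true, g]
      generalize fpSem f (i+1) X = D at hD
      obtain ⟨r, hr, hrk⟩ := ps_rank g hg D hD
      have hgD : g D ⊆ D := by
        intro x hx
        rw [hD]
        intro Y hY
        exact hY (hg D Y (by rw [hD]; exact Set.sInter_subset_of_mem hY) hx)
      let L : Ordinal.{u} → Set U := fun a => {y | y ∈ D ∧ r y < a}
      choose Q hQ1 hQ2 using fun a : Ordinal.{u} =>
        ih (fun j => if (j : ℕ) = i then L a else X j)
      -- rank bounded version
      refine ⟨fun p x y => if p = i then r y < r x else
        r y ≤ r x ∧ (r y = r x → Q (r x) p x y), ?_, ?_⟩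
      · intro x p h1 h2
        have hle : ∀ n, r (x (n+1)) ≤ r (x n) := by
          intro n
          have := h2 n
          dsimp only at this
          split_ifs at this with h
          · exact this.le
          · exact this.1
        have hanti : Antitone (fun n => r (x n)) := antitone_nat_of_succ_le hle
        obtain ⟨N, hN⟩ : ∃ N, ∀ m, r (x N) ≤ r (x m) := by
          obtain ⟨N, hN⟩ := csInf_mem (Set.range_nonempty (fun n => r (x n)))
          refine ⟨N, fun m => ?_⟩
          have hN' : r (x N) = sInf (Set.range (fun n => r (x n))) := hN
          rw [hN']
          exact csInf_le' ⟨m, rfl⟩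
        have hc : ∀ n, N ≤ n → r (x n) = r (x N) := fun n hn =>
          le_antisymm (hanti hn) (hN n)
        have hp : ∀ n, N ≤ n → p n < i ∧ Q (r (x N)) (p n) (x n) (x (n+1)) := by
          intro n hn
          have := h2 n
          have e1 := hc n hn
          have e2 := hc (n+1) (by omega)
          dsimp only at this
          split_ifs at this with h
          · rw [e1, e2] at this
            exact absurd this (lt_irrefl _)
          · refine ⟨by have := h1 n; omega, ?_⟩
            rw [e1, e2] at this
            exact this.2 rfl
        exact (hQ1 (r (x N))).tail x p N (fun n hn => (hp n hn).1) (fun n hn => (hp n hn).2)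
      · intro x hx
        refine hf _ _ ?_ (hQ2 (r x) x (hr x hx))
        intro j y hy
        by_cases h1 : (j : ℕ) < i
        · simp only [h1, if_true, show (j : ℕ) < i + 1 by omega] at hy ⊢
          have hyg : y ∈ g (L (r x)) := hy.1
          refine ⟨hgD (hg _ _ (fun z hz => hz.1) hyg), ?_⟩
          have h3 : ¬ (j : ℕ) = i := by omega
          simp only [h3, if_false]
          exact ⟨hrk _ _ hyg, fun _ => hy.2⟩
        · by_cases h2 : (j : ℕ) = i
          · simp only [h2, lt_irrefl, if_false, if_true, Nat.lt_succ_self] at hy ⊢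
            exact hy
          · simp only [h1, h2, if_false, show ¬ (j : ℕ) < i + 1 by omega] at hy ⊢
            exact hy
    · have hD : fpSem f (i+1) X = ⋃₀ {Y | Y ⊆ g Y} := by
        simp only [fpSem, hi, if_false, g]
      generalize fpSem f (i+1) X = D at hD
      have hDg : D ⊆ g D := by
        intro x hx
        rw [hD] at hx
        obtain ⟨Y, hY, hx⟩ := hx
        exact hg Y D (by rw [hD]; exact Set.subset_sUnion_of_mem hY) (hY hx)
      have hgD : g D ⊆ D := by
        intro x hx
        rw [hD]
        exact ⟨g D, hg _ _ hDg, hx⟩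
      obtain ⟨Q, hQ1, hQ2⟩ := ih (fun j => if (j : ℕ) = i then D else X j)
      refine ⟨fun p x y => p < i → Q p x y, ?_, ?_⟩
      · intro x p h1 h2
        by_cases hfr : ∃ᶠ n in atTop, p n = i
        · exact ⟨i, Nat.odd_iff.2 (by omega), hfr, Eventually.of_forall fun n => by
            have := h1 n; omega⟩
        · rw [not_frequently, eventually_atTop] at hfr
          obtain ⟨N, hN⟩ := hfr
          have h3 : ∀ n, N ≤ n → p n < i := fun n hn => by
            have := h1 n
            have := hN n hn
            omega
          exact hQ1.tail x p N h3 (fun n hn => h2 n (h3 n hn))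
      · intro x hx
        refine hf _ _ ?_ (hQ2 x (hDg hx))
        intro j y hy
        by_cases h1 : (j : ℕ) < i
        · simp only [h1, if_true, show (j : ℕ) < i + 1 by omega] at hy ⊢
          exact ⟨hgD hy.1, fun _ => hy.2⟩
        · by_cases h2 : (j : ℕ) = i
          · simp only [h2, lt_irrefl, if_false, if_true, Nat.lt_succ_self] at hy ⊢
            exact ⟨hy, fun h => by exfalso; omega⟩
          · simp only [h1, h2, if_false, show ¬ (j : ℕ) < i + 1 by omega] at hy ⊢
            exact hy


theorem ps_dattr_mono {V : Type*} (Vex : Set V) (E : V → Set V) (Ω : V → ℕ) (W : Set V) {k : ℕ}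
    (X Y : Fin k → Set (Wᶜ : Set V)) (h : ∀ j, X j ⊆ Y j) :
    DAttr Vex E Ω W X ⊆ DAttr Vex E Ω W Y := by
  rintro v ⟨σ, h1, h2⟩
  refine ⟨σ, h1, fun π a b c => ?_⟩
  obtain ⟨n, p1, p2, p3, p4, j, p5, p6⟩ := h2 π a b c
  exact ⟨n, p1, p2, p3, p4, j, p5, Set.image_mono (h j) p6⟩

theorem ps_reach_step {V : Type*} {E : V → Set V} {W : Set V} {v w w' : V}
    (h : ReachThroughDAG E W v w) (he : w' ∈ E w) (hw : w' ∈ W) : ReachThroughDAG E W v w' := by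
  obtain ⟨p, n, h0, hn, hE, hW⟩ := h
  refine ⟨fun i => if i ≤ n then p i else w', n + 1, by simp [h0], by simp, ?_, ?_⟩
  · intro i hi
    by_cases h : i < n
    · simp only [show i ≤ n by omega, show i + 1 ≤ n by omega, if_true]
      exact hE i h
    · have : i = n := by omega
      subst this
      simpa [hn] using he
  · intro i h1 h2
    by_cases h : i ≤ n
    · simpa [h] using hW i h1 h
    · simpa [h] using hw

/-- A finite compatible prefix extends to an infinite compatible play. -/
theorem ps_extend {V : Type*} (Vex : Set V) (E : V → Set V) (hNE : ∀ v : V, (E v).Nonempty)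
    (σ : V → V) (hσ : ∀ u, u ∈ Vex → (E u).Nonempty → σ u ∈ E u) (p : ℕ → V) (n : ℕ)
    (hE : ∀ i, i < n → p (i+1) ∈ E (p i))
    (hc : ∀ i, i < n → p i ∈ Vex → p (i+1) = σ (p i)) :
    ∃ q : ℕ → V, (∀ i, i ≤ n → q i = p i) ∧ (∀ i, q (i+1) ∈ E (q i)) ∧
      ∀ i, q i ∈ Vex → q (i+1) = σ (q i) := by
  classical
  let st : V → V := fun u => if u ∈ Vex then σ u else (hNE u).choose
  have hst : ∀ u, st u ∈ E u := by
    intro u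
    by_cases h : u ∈ Vex
    · simpa [st, h] using hσ u h (hNE u)
    · simpa [st, h] using (hNE u).choose_spec
  let q : ℕ → V := fun i => if i ≤ n then p i else st^[i - n] (p n)
  have h1 : ∀ i, i ≤ n → q i = p i := fun i hi => by simp [q, hi]
  have h2 : ∀ i, n ≤ i → q (i+1) = st (q i) := by
    intro i hi
    have e1 : q i = st^[i - n] (p n) := by
      by_cases h : i ≤ n
      · have : i = n := by omega
        subst this
        simp [q]
      · simp [q, h]
    have e2 : q (i+1) = st^[i + 1 - n] (p n) := by
      simp [q, show ¬ (i + 1 ≤ n) by omega]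
    rw [e1, e2, show i + 1 - n = (i - n) + 1 by omega, Function.iterate_succ_apply']
  refine ⟨q, h1, fun i => ?_, fun i hi => ?_⟩
  · by_cases h : i < n
    · rw [h1 i h.le, h1 (i+1) h]
      exact hE i h
    · rw [h2 i (by omega)]
      exact hst _
  · by_cases h : i < n
    · rw [h1 i h.le] at hi ⊢
      rw [h1 (i+1) h]
      exact hc i h hi
    · rw [h2 i (by omega)]
      simp [st, hi]

/-- A play agreeing with `σ` as long as it stays in `W ∪ {v}` reaches the goal. -/
theorem ps_segment {V : Type*} (Vex : Set V) (E : V → Set V) (Ω : V → ℕ) (W : Set V) {k : ℕ}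
    (hNE : ∀ v : V, (E v).Nonempty) (Vbar : Fin k → Set V) (v : V) (σ : V → V)
    (hσ : ∀ u : V, u ∈ Vex → (E u).Nonempty → σ u ∈ E u)
    (H : ∀ π : ℕ → V, π 0 = v → (∀ i, π (i+1) ∈ E (π i)) →
      (∀ i, π i ∈ Vex → π (i+1) = σ (π i)) →
      ∃ n, 1 ≤ n ∧ π n ∉ W ∧ π n ≠ v ∧
        (∀ i, 1 ≤ i → i < n → (π i ∈ W ∨ π i = v)) ∧
        ∃ j : Fin k, (j : ℕ) + 1 = (Finset.range (n+1)).sup (fun i => Ω (π i)) ∧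
          π n ∈ Vbar j)
    (π : ℕ → V) (h0 : π 0 = v) (hE : ∀ i, π (i+1) ∈ E (π i))
    (hc : ∀ i, (∀ i', i' ≤ i → π i' ∈ W ∨ π i' = v) → π i ∈ Vex → π (i+1) = σ (π i)) :
    ∃ n, 1 ≤ n ∧ ∃ j : Fin k, (j : ℕ) + 1 = (Finset.range (n+1)).sup (fun i => Ω (π i)) ∧
          π n ∈ Vbar j := by
  classical
  by_cases hex : ∃ n, ¬ (π n ∈ W ∨ π n = v)
  · let n := Nat.find hex
    have hn : ¬ (π n ∈ W ∨ π n = v) := Nat.find_spec hex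
    have hmin : ∀ i, i < n → π i ∈ W ∨ π i = v := fun i hi => not_not.1 (Nat.find_min hex hi)
    obtain ⟨q, q1, q2, q3⟩ := ps_extend Vex E hNE σ hσ π n (fun i _ => hE i)
      (fun i hi => hc i (fun i' hi' => hmin i' (by omega)))
    obtain ⟨m, m1, m2, m3, m4, j, m5, m6⟩ := H q (by rw [q1 0 (by omega), h0]) q2 q3
    have hmn : m = n := by
      rcases lt_trichotomy m n with h | h | h
      · have := hmin m h
        rw [← q1 m h.le] at this
        tauto
      · exact h
      · have hn0 : n ≠ 0 := by
          intro h'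
          rw [h'] at hn
          exact hn (Or.inr h0)
        have := m4 n (by omega) h
        rw [q1 n le_rfl] at this
        exact absurd this hn
    rw [hmn] at m1 m5 m6
    refine ⟨n, m1, j, ?_, by rw [← q1 n le_rfl]; exact m6⟩
    rw [m5]
    refine Finset.sup_congr rfl fun i hi => ?_
    rw [q1 i (by have := Finset.mem_range.1 hi; omega)]
  · push Not at hex
    obtain ⟨m, m1, m2, m3, m4, j, m5, m6⟩ := H π h0 hE
      (fun i => hc i (fun i' _ => by have := hex i'; tauto))
    exact ⟨m, m1, j, m5, m6⟩

theorem ps_pos {V : Type*} (k : ℕ)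
    (Vex : Set V) (E : V → Set V) (Ω : V → ℕ)
    (hNE : ∀ v : V, (E v).Nonempty)
    (W : Set V) (hW : IsPositionalDAG Vex E W) (v : (Wᶜ : Set V))
    (hv : v ∈ fpSem (fun X : Fin k → Set (Wᶜ : Set V) => DAttr Vex E Ω W X) k (fun _ => ∅)) :
    PosWinsFrom Vex E (ParityWinsPlay Ω) (v : V) := by
  classical
  obtain ⟨R, hR, hD⟩ := ps_main (fun X : Fin k → Set (Wᶜ : Set V) => DAttr Vex E Ω W X)
    (fun X Y h => ps_dattr_mono Vex E Ω W X Y h) k (fun _ => ∅)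
  generalize fpSem (fun X : Fin k → Set (Wᶜ : Set V) => DAttr Vex E Ω W X) k (fun _ => ∅) = D
    at hv hD
  simp only [Fin.is_lt, if_true] at hD
  have hS : ∀ u : V, ∃ σ : V → V, (∀ u : V, u ∈ Vex → (E u).Nonempty → σ u ∈ E u) ∧
      ∀ h : u ∈ Wᶜ, (⟨u, h⟩ : (Wᶜ : Set V)) ∈ D →
      ∀ π : ℕ → V, π 0 = u → (∀ i, π (i+1) ∈ E (π i)) →
      (∀ i, π i ∈ Vex → π (i+1) = σ (π i)) →
      ∃ n, 1 ≤ n ∧ π n ∉ W ∧ π n ≠ u ∧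
        (∀ i, 1 ≤ i → i < n → (π i ∈ W ∨ π i = u)) ∧
        ∃ j : Fin k, (j : ℕ) + 1 = (Finset.range (n+1)).sup (fun i => Ω (π i)) ∧
          π n ∈ Subtype.val '' {y : (Wᶜ : Set V) | y ∈ D ∧ R j ⟨u, h⟩ y} := by
    intro u
    by_cases h : ∃ h : u ∈ Wᶜ, (⟨u, h⟩ : (Wᶜ : Set V)) ∈ D
    · obtain ⟨h, hu⟩ := h
      obtain ⟨σ, h1, h2⟩ := hD _ hu
      exact ⟨σ, h1, fun _ _ => h2⟩
    · exact ⟨fun u => (hNE u).choose, fun u _ _ => (hNE u).choose_spec,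
        fun h1 h2 => absurd ⟨h1, h2⟩ h⟩
  choose S hS1 hS2 using hS
  let org : V → V := fun u => if u ∈ W then
    (if h : ∃ r, r ∉ W ∧ ReachThroughDAG E W r u then h.choose else u) else u
  have horg : ∀ r u, r ∉ W → u ∈ Vex → ReachThroughDAG E W r u → (u ∈ W ∨ u = r) →
      org u = r := by
    intro r u hr hu hreach hor
    by_cases huW : u ∈ W
    · have h : ∃ r, r ∉ W ∧ ReachThroughDAG E W r u := ⟨r, hr, hreach⟩
      have e : org u = h.choose := by simp only [org, huW, if_true, h, dif_pos]
      rw [e]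
      exact (hW.2 u ⟨huW, hu⟩).unique h.choose_spec ⟨hr, hreach⟩
    · simp only [org, huW, if_false]
      tauto
  refine ⟨fun u => S (org u) u, fun u h1 h2 => hS1 _ u h1 h2, fun p n _ _ _ _ => hNE _, ?_⟩
  intro π h0 hE hc
  -- one large step
  let T := {t : ℕ // ∃ h : π t ∈ Wᶜ, (⟨π t, h⟩ : (Wᶜ : Set V)) ∈ D}
  let nd : T → (Wᶜ : Set V) := fun t => ⟨π t.1, t.2.1⟩
  have step : ∀ t : T, ∃ t' : T, ∃ j : ℕ, t.1 < t'.1 ∧ j < k ∧ R j (nd t) (nd t') ∧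
      (∀ i, t.1 ≤ i → i ≤ t'.1 → Ω (π i) ≤ j + 1) ∧
      ∃ i, t.1 ≤ i ∧ i ≤ t'.1 ∧ Ω (π i) = j + 1 := by
    rintro ⟨t, ht, htD⟩
    have hreach : ∀ i, (∀ i', i' ≤ i → π (t + i') ∈ W ∨ π (t + i') = π t) →
        ReachThroughDAG E W (π t) (π (t + i)) := by
      have hrefl : ReachThroughDAG E W (π t) (π t) :=
        ⟨fun _ => π t, 0, rfl, rfl, fun i hi => by omega, fun i h1 h2 => by omega⟩
      intro i
      induction i with
      | zero => intro _; exact hrefl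
      | succ i ih =>
        intro h
        rcases h (i+1) le_rfl with h1 | h1
        · exact ps_reach_step (ih fun i' hi' => h i' (by omega)) (hE (t + i)) h1
        · rw [h1]; exact hrefl
    obtain ⟨n, n1, j, n2, ⟨⟨y, hy⟩, ⟨hyD, hyR⟩, hyn⟩⟩ := ps_segment Vex E Ω W hNE _ (π t)
      (S (π t)) (hS1 _) (hS2 _ ht htD)
      (fun i => π (t + i)) rfl (fun i => hE (t + i)) (by
        intro i hi hex
        have := hc (t + i) hex
        try dsimp only at this
        rw [horg (π t) (π (t + i)) ht hex (hreach i hi) (hi i le_rfl)] at this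
        exact this)
    dsimp only at hyn n2
    subst hyn
    refine ⟨⟨t + n, hy, hyD⟩, j, by show t < t + n; omega, j.2, hyR, ?_, ?_⟩
    · intro i h1 h2
      try dsimp only at h1 h2
      rw [n2]
      have := Finset.le_sup (f := fun i => Ω (π (t + i))) (s := Finset.range (n+1)) (b := i - t)
        (Finset.mem_range.2 (by omega))
      try dsimp only at this
      rwa [show t + (i - t) = i by omega] at this
    · obtain ⟨i, hi, he⟩ := Finset.exists_mem_eq_sup (Finset.range (n+1)) ⟨0, by simp⟩
        (fun i => Ω (π (t + i)))
      have := Finset.mem_range.1 hi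
      exact ⟨t + i, by show t ≤ t + i; omega, by show t + i ≤ t + n; omega, by rw [n2, he]⟩
  choose nx pr s1 s2 s3 s4 s5 using step
  let t0 : T := ⟨0, by rw [h0]; exact ⟨v.2, hv⟩⟩
  let s : ℕ → T := fun n => nx^[n] t0
  have hs : ∀ n, s (n+1) = nx (s n) := fun n => Function.iterate_succ_apply' nx n t0
  have hmono : StrictMono (fun n => (s n).1) := strictMono_nat_of_lt_succ fun n => by
    rw [hs]; exact s1 _
  obtain ⟨m, hm, hfr, hev⟩ := hR (fun n => nd (s n)) (fun n => pr (s n)) (fun n => s2 _)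
    (fun n => by rw [hs]; exact s3 _)
  refine ⟨m + 1, hm.add_one, ?_, ?_⟩
  · rw [frequently_atTop] at hfr ⊢
    intro a
    obtain ⟨b, hb, hbm⟩ := hfr a
    obtain ⟨i, i1, i2, i3⟩ := s5 (s b)
    refine ⟨i, ?_, by rw [i3, hbm]⟩
    have : b ≤ (s b).1 := hmono.id_le b
    omega
  · obtain ⟨N, hN⟩ := eventually_atTop.1 hev
    have hall : ∀ i, (s N).1 ≤ i → Ω (π i) ≤ m + 1 := by
      intro i hi
      have hex : ∃ n, i < (s n).1 := ⟨i + 1, lt_of_lt_of_le (Nat.lt_succ_self i)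
        (hmono.id_le (i+1))⟩
      have f1 := Nat.find_spec hex
      have f2 := fun b => Nat.find_min hex (m := b)
      generalize Nat.find hex = c at f1 f2
      have hNc : N < c := by
        by_contra h
        have : (s c).1 ≤ (s N).1 := hmono.monotone (by omega)
        omega
      obtain ⟨b, rfl⟩ : ∃ b, c = b + 1 := ⟨c - 1, by omega⟩
      have f3 := f2 b (by omega)
      rw [hs] at f1
      have := s4 (s b) i (by omega) f1.le
      have := hN b (by omega)
      omega
    intro q hq
    rw [eventually_atTop]
    refine ⟨(s N).1, fun i hi he => ?_⟩
    have := hall i hi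
    omega

/-- Soundness direction of large-step solving: every real node contained in the nested
fixpoint `d = ν X_k. μ X_{k-1}. … . μ X_1. DAttr_W(X_1,…,X_k)` (over subsets of
`V' = V ∖ W`) is won by player ∃ in `G`, i.e. `d ⊆ Win_G`; moreover player ∃ has a
positional winning strategy in `G` from every node of `d`. -/
theorem statement3 {V : Type*} (k : ℕ) (hk : Even k)
    (Vex : Set V) (E : V → Set V) (Ω : V → ℕ)
    (hNE : ∀ v : V, (E v).Nonempty)
    (hΩ : ∀ v : V, 1 ≤ Ω v ∧ Ω v ≤ k)
    (W : Set V) (hW : IsPositionalDAG Vex E W) :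
    ∀ v : (Wᶜ : Set V),
      v ∈ fpSem (fun X : Fin k → Set (Wᶜ : Set V) => DAttr Vex E Ω W X) k (fun _ => ∅) →
        WinsFrom Vex E (ParityWinsPlay Ω) (v : V) ∧
        PosWinsFrom Vex E (ParityWinsPlay Ω) (v : V) := by
  intro v hv
  have hp := ps_pos k Vex E Ω hNE W hW v hv
  refine ⟨?_, hp⟩
  obtain ⟨σ, h1, h2, h3⟩ := hp
  exact ⟨fun _ u => σ u, fun _ u => h1 u, h2, h3⟩
end

section
/- Let G=(V_∃,V_∀,E,γ_C,φ_C) be an Emerson-Lei game over a finite set C of colors and let P(G) be the parity game obtained by the later-appearance-record construction. If player ∃ has a winning strategy with memory Π(C) in G from a node v, then for every permutation π∈Π(C), player ∃ has a winning strategy in P(G) from (v,π). In particular, the strategy ρ with memory Π(C) for P(G) that updates its memory and chooses moves exactly as the given strategy for G does (additionally updating the permutation component of game nodes according to the taken moves) wins every node (v,π) with v∈Win_G. -/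
open Filter

/-- Boolean formulas over atoms `Inf(c)`, `c ∈ C` (with `Fin(c) = ¬ Inf(c)`). -/
inductive ELForm (C : Type*) : Type _
  | inf : C → ELForm C
  | neg : ELForm C → ELForm C
  | and : ELForm C → ELForm C → ELForm C
  | or : ELForm C → ELForm C → ELForm C

/-- Satisfaction of an Emerson-Lei formula under a valuation of the atoms `Inf(c)`. -/
def ELForm.sat {C : Type*} (val : C → Prop) : ELForm C → Prop
  | .inf c => val c
  | .neg φ => ¬ ELForm.sat val φ
  | .and φ ψ => ELForm.sat val φ ∧ ELForm.sat val ψ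
  | .or φ ψ => ELForm.sat val φ ∨ ELForm.sat val ψ

/-- A play satisfies the Emerson-Lei objective iff the formula `φ` holds when each atom
`Inf(c)` is interpreted as "`c` occurs in the coloring of infinitely many positions". -/
def ELWinsPlay {V C : Type*} (γC : V → Finset C) (φ : ELForm C) (π : ℕ → V) : Prop :=
  ELForm.sat (fun c => ∃ᶠ i in atTop, c ∈ γC (π i)) φ

/-- `l` is an ordering (permutation) of the finite set `C`. -/
def IsOrdering {C : Type*} (l : List C) : Prop := l.Nodup ∧ ∀ c : C, c ∈ l

/-- `larUpd l D` is `l@D`: the element of `D` occurring at the rightmost position of `l`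
is moved to the front of `l` (and `l@∅ = l`). -/
def larUpd {C : Type*} [DecidableEq C] (l : List C) (D : Finset C) : List C :=
  match (l.filter fun c => decide (c ∈ D)).getLast? with
  | none => l
  | some c => c :: l.erase c

/-- `larPos l D` is the rightmost (1-based) position of `l` containing an element of `D`
(and `0` if there is none). -/
def larPos {C : Type*} [DecidableEq C] (l : List C) (D : Finset C) : ℕ :=
  match (l.filter fun c => decide (c ∈ D)).getLast? with
  | none => 0
  | some c => l.idxOf c + 1

/-- The priority function of the LAR parity game `P(G)`: `Ω(v,π) = 2p` if `π[p] ⊨ φ` and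
`Ω(v,π) = 2p+1` otherwise, where `p` is the rightmost position of `π` containing a color
of `γ_C(v)` and `π[p]` is the set of colors at the first `p` positions of `π`. -/
noncomputable def larPrio {V C : Type*} [DecidableEq C] (γC : V → Finset C) (φ : ELForm C)
    (q : V × List C) : ℕ :=
  haveI : Decidable (ELForm.sat (fun c => c ∈ q.2.take (larPos q.2 (γC q.1))) φ) :=
    Classical.propDecidable _
  if ELForm.sat (fun c => c ∈ q.2.take (larPos q.2 (γC q.1))) φ then
    2 * larPos q.2 (γC q.1)
  else 2 * larPos q.2 (γC q.1) + 1

/-- Nodes of `P(G)` owned by player ∃: pairs whose first component is owned by ∃ in `G`. -/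
def prodVex {V : Type*} (C : Type*) (Vex : Set V) : Set (V × List C) := {q | q.1 ∈ Vex}

/-- Moves of `P(G)`: `E'(v,π) = {(w, π@γ_C(v)) ∣ (v,w) ∈ E}`. -/
def prodE {V C : Type*} [DecidableEq C] (E : V → Set V) (γC : V → Finset C)
    (q : V × List C) : Set (V × List C) :=
  {r | ∃ w ∈ E q.1, r = (w, larUpd q.2 (γC q.1))}

/-- The memory value obtained by iterating the update function along a play from the
initial memory value `m0`. -/
def memAt {M V : Type*} (upd : M → V × V → M) (m0 : M) (π : ℕ → V) : ℕ → M
  | 0 => m0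
  | i+1 => upd (memAt upd m0 π i) (π i, π (i+1))

/-- The strategy with memory `M` given by `(m0, upd, mov)` is winning for player ∃ from
`v`: it prescribes legal moves, compatible finite plays never get stuck at a node of
player ∃, and every compatible infinite play from `v` is winning. -/
def MemWinsFrom {M V : Type*} (Vex : Set V) (E : V → Set V) (WinPlay : (ℕ → V) → Prop)
    (m0 : M) (upd : M → V × V → M) (mov : V → M → V) (v : V) : Prop :=
  (∀ (u : V) (m : M), u ∈ Vex → (E u).Nonempty → mov u m ∈ E u) ∧
  (∀ (p : ℕ → V) (n : ℕ), p 0 = v → (∀ i, i < n → p (i+1) ∈ E (p i)) →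
      (∀ i, i < n → p i ∈ Vex → p (i+1) = mov (p i) (memAt upd m0 p i)) →
      p n ∈ Vex → (E (p n)).Nonempty) ∧
  (∀ π : ℕ → V, π 0 = v → (∀ i, π (i+1) ∈ E (π i)) →
      (∀ i, π i ∈ Vex → π (i+1) = mov (π i) (memAt upd m0 π i)) → WinPlay π)

theorem lar_decomp {C : Type*} [DecidableEq C] (l : List C) (D : Finset C) :
    (∀ d ∈ l, d ∉ D) ∨ ∃ a c b, l = a ++ c :: b ∧ c ∈ D ∧ ∀ d ∈ b, d ∉ D := by
  induction l with
  | nil => left; simp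
  | cons x l ih =>
    rcases ih with h | ⟨a, c, b, rfl, hc, hb⟩
    · by_cases hx : x ∈ D
      · right; exact ⟨[], x, l, rfl, hx, h⟩
      · left; simpa [hx] using h
    · right; exact ⟨x :: a, c, b, rfl, hc, hb⟩

theorem lar_spec {C : Type*} [DecidableEq C] (l : List C) (D : Finset C) (hl : IsOrdering l) :
    (larPos l D = 0 ∧ larUpd l D = l ∧ ∀ d, d ∉ D) ∨
    ∃ a c b, l = a ++ c :: b ∧ c ∈ D ∧ (∀ d ∈ b, d ∉ D) ∧ larPos l D = a.length + 1 ∧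
      larUpd l D = c :: (a ++ b) := by
  rcases lar_decomp l D with h | ⟨a, c, b, rfl, hc, hb⟩
  · left
    have : (l.filter fun c => decide (c ∈ D)) = [] := by
      simpa [List.filter_eq_nil_iff] using h
    refine ⟨by simp [larPos, this], by simp [larUpd, this], fun d => h d (hl.2 d)⟩
  · right
    refine ⟨a, c, b, rfl, hc, hb, ?_⟩
    have h1 : ((a ++ c :: b).filter fun c => decide (c ∈ D)).getLast? = some c := by
      have : (b.filter fun c => decide (c ∈ D)) = [] := by
        simpa [List.filter_eq_nil_iff] using hb
      simp [List.filter_append, List.filter_cons, hc, this]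
    have hca : c ∉ a := by
      have := hl.1
      rw [List.nodup_append] at this
      intro h
      exact this.2.2 c h c (by simp) rfl
    constructor
    · unfold larPos; rw [h1]; simp [List.idxOf_append, hca]
    · unfold larUpd; rw [h1]; simp [List.erase_append, hca]

theorem lar_ord {C : Type*} [DecidableEq C] (l : List C) (D : Finset C) (hl : IsOrdering l) :
    IsOrdering (larUpd l D) := by
  rcases lar_spec l D hl with ⟨_, h, _⟩ | ⟨a, c, b, rfl, hc, hb, hp, hu⟩
  · rwa [h]
  · rw [hu]
    have hp : (a ++ c :: b).Perm (c :: (a ++ b)) := List.perm_middle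
    exact ⟨hp.nodup_iff.1 hl.1, fun d => hp.mem_iff.1 (hl.2 d)⟩

theorem lar_idx {C : Type*} [DecidableEq C] (l : List C) (D : Finset C) (hl : IsOrdering l)
    (d : C) :
    (larPos l D ≤ l.idxOf d ∧ (larUpd l D).idxOf d = l.idxOf d ∧ d ∉ D) ∨
    (l.idxOf d + 1 < larPos l D ∧ (larUpd l D).idxOf d = l.idxOf d + 1) ∨
    (l.idxOf d + 1 = larPos l D ∧ (larUpd l D).idxOf d = 0 ∧ d ∈ D) := by
  rcases lar_spec l D hl with ⟨h0, h, hD⟩ | ⟨a, c, b, rfl, hc, hb, hp, hu⟩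
  · left; simp [h0, h, hD]
  · rw [hp, hu]
    have hn := hl.1
    rw [List.nodup_append] at hn
    have hm := hl.2 d
    by_cases hdc : d = c
    · subst hdc
      have hca : d ∉ a := fun h => hn.2.2 d h d (by simp) rfl
      right; right
      simp [List.idxOf_append, hca, hc]
    · by_cases hda : d ∈ a
      · right; left
        have := List.idxOf_lt_length_of_mem hda
        simp [List.idxOf_append, hda, List.idxOf_cons_ne _ (Ne.symm hdc), this]
      · have hdb : d ∈ b := by simpa [hda, hdc] using hm
        left
        refine ⟨?_, ?_, hb d hdb⟩
        · simp [List.idxOf_append, hda, List.idxOf_cons_ne _ (Ne.symm hdc)]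
        · simp [List.idxOf_append, hda, List.idxOf_cons_ne _ (Ne.symm hdc)]; omega

theorem lar_pos_le {C : Type*} [Fintype C] [DecidableEq C] (l : List C) (D : Finset C)
    (hl : IsOrdering l) : larPos l D ≤ Fintype.card C := by
  have h1 : l.length ≤ Fintype.card C := hl.1.length_le_card
  rcases lar_spec l D hl with ⟨h0, h, hD⟩ | ⟨a, c, b, rfl, hc, hb, hp, hu⟩
  · omega
  · simp at h1; omega

theorem lar_limsup (p : ℕ → ℕ) (B : ℕ) (hB : ∀ i, p i ≤ B) :
    ∃ k, (∃ᶠ i in atTop, p i = k) ∧ ∀ᶠ i in atTop, p i ≤ k := by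
  classical
  have hex : ∃ k, ∀ᶠ i in atTop, p i ≤ k := ⟨B, Eventually.of_forall hB⟩
  refine ⟨Nat.find hex, ?_, Nat.find_spec hex⟩
  intro hne
  have hs := Nat.find_spec hex
  have h2 : ∀ᶠ i in atTop, p i < Nat.find hex := by
    filter_upwards [hne, hs] with i h1 h2
    exact lt_of_le_of_ne h2 h1
  obtain ⟨i, hi⟩ := h2.exists
  refine Nat.find_min hex (m := Nat.find hex - 1) (by omega) ?_
  filter_upwards [h2] with i hi
  omega

theorem lar_abs (p f : ℕ → ℕ) (s : ℕ → Prop) (k N : ℕ)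
    (hk : ∃ᶠ i in atTop, p i = k) (hN : ∀ i, N ≤ i → p i ≤ k)
    (h : ∀ i, (p i ≤ f i ∧ f (i+1) = f i ∧ ¬ s i) ∨ (f i + 1 < p i ∧ f (i+1) = f i + 1) ∨
      (f i + 1 = p i ∧ f (i+1) = 0 ∧ s i)) (n : ℕ) (hn : N ≤ n) :
    f n < k ↔ ∃ᶠ i in atTop, s i := by
  have stab : ∀ j, N ≤ j → (f j < k ↔ f N < k) := by
    intro j hj
    induction j, hj using Nat.le_induction with
    | base => rfl
    | succ j hj ih =>
      rw [← ih]
      have := hN j hj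
      rcases h j with h | h | h <;> omega
  rw [stab n hn]
  constructor
  · intro hlt hns
    have hns' : ∀ᶠ i in atTop, ¬ s i := hns
    obtain ⟨M, hM⟩ := eventually_atTop.1 hns'
    have mono : ∀ i j, max M N ≤ i → i ≤ j → f i ≤ f j := by
      intro i j hi hij
      induction j, hij using Nat.le_induction with
      | base => exact le_rfl
      | succ j hj ih =>
        have hs := hM j (by omega)
        rcases h j with h | h | h
        · omega
        · omega
        · exact absurd h.2.2 hs
    have grow : ∀ t, ∃ i, max M N ≤ i ∧ t ≤ f i := by
      intro t
      induction t with
      | zero => exact ⟨_, le_rfl, Nat.zero_le _⟩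
      | succ t ih =>
        obtain ⟨i, hi, hti⟩ := ih
        obtain ⟨j, hj, hpj⟩ := frequently_atTop.1 hk i
        have h1 := mono i j hi hj
        have h2 := (stab j (by omega)).2 hlt
        have hs := hM j (by omega)
        refine ⟨j+1, by omega, ?_⟩
        rcases h j with h | h | h
        · omega
        · omega
        · exact absurd h.2.2 hs
    obtain ⟨i, hi, hki⟩ := grow k
    have := (stab i (by omega)).2 hlt
    omega
  · intro hs
    obtain ⟨j, hj, hsj⟩ := frequently_atTop.1 hs N
    rw [← stab j hj]
    have := hN j hj
    rcases h j with h | h | h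
    · exact absurd hsj h.2.2
    · omega
    · omega

theorem lar_play {V C : Type*} [Fintype C] [DecidableEq C] (γC : V → Finset C) (φ : ELForm C)
    (q : ℕ → V × List C) (h0 : IsOrdering (q 0).2)
    (hq : ∀ i, (q (i+1)).2 = larUpd (q i).2 (γC (q i).1))
    (hw : ELWinsPlay γC φ (fun i => (q i).1)) : ParityWinsPlay (larPrio γC φ) q := by
  have hord : ∀ i, IsOrdering (q i).2 := by
    intro i
    induction i with
    | zero => exact h0
    | succ i ih => rw [hq]; exact lar_ord _ _ ih
  obtain ⟨k, hk, hle⟩ := lar_limsup (fun i => larPos (q i).2 (γC (q i).1)) _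
    (fun i => lar_pos_le _ _ (hord i))
  obtain ⟨N, hN⟩ := eventually_atTop.1 hle
  have key : ∀ n, N ≤ n → ∀ c, (c ∈ (q n).2.take k ↔ ∃ᶠ i in atTop, c ∈ γC (q i).1) := by
    intro n hn c
    rw [List.mem_take_iff_idxOf_lt ((hord n).2 c)]
    refine lar_abs (fun i => larPos (q i).2 (γC (q i).1)) (fun i => (q i).2.idxOf c)
      (fun i => c ∈ γC (q i).1) k N hk hN ?_ n hn
    intro i
    simp only [hq i]
    exact lar_idx _ _ (hord i) c
  have sat : ∀ n, N ≤ n → ELForm.sat (fun c => c ∈ (q n).2.take k) φ := by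
    intro n hn
    have : (fun c => c ∈ (q n).2.take k) = fun c => ∃ᶠ i in atTop, c ∈ γC (q i).1 := by
      funext c; exact propext (key n hn c)
    rw [this]; exact hw
  have prio : ∀ n, N ≤ n → larPos (q n).2 (γC (q n).1) = k → larPrio γC φ (q n) = 2 * k := by
    intro n hn hp
    unfold larPrio
    rw [hp, if_pos (sat n hn)]
  refine ⟨2 * k, even_two_mul k, ?_, ?_⟩
  · have := hk.and_eventually (eventually_ge_atTop N)
    exact this.mono fun i hi => prio i hi.2 hi.1
  · intro r hr
    filter_upwards [eventually_ge_atTop N] with i hi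
    have h1 := hN i hi
    rcases Nat.lt_or_eq_of_le h1 with h | h
    · have : larPrio γC φ (q i) ≤ 2 * larPos (q i).2 (γC (q i).1) + 1 := by
        unfold larPrio
        split_ifs <;> omega
      omega
    · rw [prio i hi h]; omega

theorem memAt_fst {M V L : Type*} (upd : M → V × V → M) (m0 : M) (q : ℕ → V × L) (i : ℕ) :
    memAt (fun m (e : (V × L) × (V × L)) => upd m (e.1.1, e.2.1)) m0 q i
      = memAt upd m0 (fun i => (q i).1) i := by
  induction i with
  | zero => rfl
  | succ i ih => simp only [memAt, ih]

theorem memAt_congr {M V : Type*} (upd : M → V × V → M) (m0 : M) (p q : ℕ → V) (i : ℕ)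
    (h : ∀ j, j ≤ i → p j = q j) : memAt upd m0 p i = memAt upd m0 q i := by
  induction i with
  | zero => rfl
  | succ i ih =>
    simp only [memAt]
    rw [ih (fun j hj => h j (by omega)), h i (by omega), h (i+1) le_rfl]

theorem winsFrom_of_mem {M V : Type*} (Vex : Set V) (E : V → Set V) (W : (ℕ → V) → Prop)
    (m0 : M) (upd : M → V × V → M) (mov : V → M → V) (v : V)
    (h : MemWinsFrom Vex E W m0 upd mov v) : WinsFrom Vex E W v := by
  obtain ⟨h1, h2, h3⟩ := h
  have key : ∀ (p : ℕ → V) (i : ℕ),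
      memAt upd m0 (fun j => (histList p i).getD j (p i)) (histList p i).length
        = memAt upd m0 p i := by
    intro p i
    have hlen : (histList p i).length = i := by simp [histList]
    rw [hlen]
    apply memAt_congr
    intro j hj
    rcases Nat.lt_or_eq_of_le hj with hj | rfl
    · rw [List.getD_eq_getElem _ _ (by omega)]
      simp [histList]
    · rw [List.getD_eq_default _ _ (by omega)]
  refine ⟨fun l u => mov u (memAt upd m0 (fun j => l.getD j u) l.length), ?_, ?_, ?_⟩
  · intro l u hu hne
    exact h1 _ _ hu hne
  · intro p n hp0 hE hs
    exact h2 p n hp0 hE (fun i hi hv => by rw [hs i hi hv]; exact congrArg _ (key p i))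
  · intro p hp0 hE hs
    exact h3 p hp0 hE (fun i hv => by rw [hs i hv]; exact congrArg _ (key p i))

/-- Forward direction of the LAR reduction: if player ∃ has a winning strategy
`σ = (Π(C), m0, upd, mov)` with memory `Π(C)` in the Emerson-Lei game `G` from `v`, then
for every permutation `π` of `C`, player ∃ has a winning strategy in `P(G)` from `(v,π)`;
in particular, the strategy `ρ` with memory `Π(C)` that updates its memory and chooses
moves exactly as `σ` does (additionally updating the permutation component of game nodes
according to the taken moves) wins every such node `(v,π)`. -/
theorem statement6 {V C : Type*} [Fintype C] [DecidableEq C]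
    (Vex : Set V) (E : V → Set V) (hNE : ∀ v : V, (E v).Nonempty)
    (γC : V → Finset C) (φ : ELForm C)
    (m0 : {l : List C // IsOrdering l})
    (upd : {l : List C // IsOrdering l} → V × V → {l : List C // IsOrdering l})
    (mov : V → {l : List C // IsOrdering l} → V)
    (v : V)
    (hwin : MemWinsFrom Vex E (ELWinsPlay γC φ) m0 upd mov v) :
    ∀ π0 : List C, IsOrdering π0 →
      WinsFrom (prodVex C Vex) (prodE E γC) (ParityWinsPlay (larPrio γC φ)) (v, π0) ∧
      MemWinsFrom (prodVex C Vex) (prodE E γC) (ParityWinsPlay (larPrio γC φ))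
        m0 (fun m e => upd m (e.1.1, e.2.1))
        (fun q m => (mov q.1 m, larUpd q.2 (γC q.1))) (v, π0) := by
  intro π0 hπ0
  suffices h : MemWinsFrom (prodVex C Vex) (prodE E γC) (ParityWinsPlay (larPrio γC φ))
        m0 (fun m e => upd m (e.1.1, e.2.1))
        (fun q m => (mov q.1 m, larUpd q.2 (γC q.1))) (v, π0) from
    ⟨winsFrom_of_mem _ _ _ _ _ _ _ h, h⟩
  obtain ⟨h1, h2, h3⟩ := hwin
  refine ⟨?_, ?_, ?_⟩
  · intro u m hu _
    exact ⟨_, h1 u.1 m hu (hNE _), rfl⟩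
  · intro p n _ _ _ _
    obtain ⟨w, hw⟩ := hNE (p n).1
    exact ⟨_, w, hw, rfl⟩
  · intro q hq0 hE hs
    have hq : ∀ i, (q (i+1)).1 ∈ E (q i).1 ∧ (q (i+1)).2 = larUpd (q i).2 (γC (q i).1) := by
      intro i
      obtain ⟨w, hw, he⟩ := hE i
      rw [he]; exact ⟨hw, rfl⟩
    refine lar_play γC φ q (by rw [hq0]; exact hπ0) (fun i => (hq i).2) ?_
    refine h3 _ (by simp [hq0]) (fun i => (hq i).1) ?_
    intro i hi
    have := hs i hi
    rw [memAt_fst] at this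
    simp only [this]
end

section
/- Let G=(V_∃,V_∀,E,γ_C,φ_C) be an Emerson-Lei game over a finite set C of colors and let P(G) be the parity game obtained by the later-appearance-record construction. If player ∃ has a positional winning strategy in P(G) from a node (v,π), then player ∃ has a winning strategy with memory Π(C) in G from v; in particular v∈Win_G. -/
open Filter

theorem larUpd_cases {C : Type*} [DecidableEq C] (l : List C) (hl : IsOrdering l) (D : Finset C) :
    (D = ∅ ∧ larPos l D = 0 ∧ larUpd l D = l) ∨
    ∃ d ∈ D, larPos l D = l.idxOf d + 1 ∧ (∀ c ∈ D, l.idxOf c ≤ l.idxOf d) ∧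
      larUpd l D = d :: l.erase d := by
  unfold larPos larUpd
  rcases h : (l.filter fun c => decide (c ∈ D)).getLast? with _ | d
  · left
    rw [List.getLast?_eq_none_iff, List.filter_eq_nil_iff] at h
    refine ⟨?_, rfl, rfl⟩
    ext c
    have := h c (hl.2 c)
    simpa using this
  · right
    rw [List.getLast?_eq_some_iff] at h
    obtain ⟨ys, h⟩ := h
    have hd : d ∈ D := by
      have : d ∈ (l.filter fun c => decide (c ∈ D)) := by rw [h]; simp
      simpa using (List.mem_filter.1 this).2
    refine ⟨d, hd, rfl, ?_, rfl⟩
    intro c hc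
    by_contra hlt
    push Not at hlt
    obtain ⟨s, t, hst⟩ := List.append_of_mem (hl.2 d)
    have hnd := hl.1
    have hds : d ∉ s := by
      rw [hst] at hnd
      rw [List.nodup_append] at hnd
      intro h1
      exact hnd.2.2 d h1 d (by simp) rfl
    have hct : c ∈ t := by
      have hcl := hl.2 c
      rw [hst] at hcl hlt
      rw [List.idxOf_append_of_notMem hds] at hlt
      simp only [List.idxOf_cons_self] at hlt
      rcases List.mem_append.1 hcl with h1 | h1
      · rw [List.idxOf_append_of_mem h1] at hlt
        have := List.idxOf_lt_length_of_mem h1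
        omega
      · rcases List.mem_cons.1 h1 with h2 | h2
        · subst h2
          exact absurd hcl (by
            rw [List.idxOf_append_of_notMem hds] at hlt
            simp at hlt)
        · exact h2
    have hcf : c ∈ t.filter fun c => decide (c ∈ D) := by simp [hct, hc]
    have h3 : (t.filter fun c => decide (c ∈ D)).getLast? = some d := by
      have h4 : (l.filter fun c => decide (c ∈ D)).getLast? = some d := by rw [h]; simp
      rw [hst, List.filter_append, List.filter_cons_of_pos (by simpa using hd)] at h4
      have hne : (t.filter fun c => decide (c ∈ D)) ≠ [] := List.ne_nil_of_mem hcf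
      rw [List.getLast?_append_of_ne_nil _ (by simp)] at h4
      rw [List.getLast?_cons] at h4
      rcases h5 : (t.filter fun c => decide (c ∈ D)).getLast? with _ | e
      · exact absurd (List.getLast?_eq_none_iff.1 h5) hne
      · rw [h5] at h4; simpa using h4
    have hdt : d ∈ t := List.mem_of_mem_filter (List.mem_of_getLast? h3)
    rw [hst, List.nodup_append] at hnd
    exact (List.nodup_cons.1 hnd.2.1).1 hdt

theorem larUpd_ord {C : Type*} [DecidableEq C] (l : List C) (hl : IsOrdering l) (D : Finset C) :
    IsOrdering (larUpd l D) := by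
  rcases larUpd_cases l hl D with ⟨_, _, h⟩ | ⟨d, _, _, _, h⟩
  · rw [h]; exact hl
  · rw [h]
    have hp : l.Perm (d :: l.erase d) := List.perm_cons_erase (hl.2 d)
    exact ⟨hp.nodup_iff.1 hl.1, fun c => hp.mem_iff.1 (hl.2 c)⟩

theorem idx_upd {C : Type*} [DecidableEq C] (l : List C) (hl : IsOrdering l) (d c : C)
    (hne : c ≠ d) :
    (d :: l.erase d).idxOf c = if l.idxOf c < l.idxOf d then l.idxOf c + 1 else l.idxOf c := by
  obtain ⟨s, t, hst⟩ := List.append_of_mem (hl.2 d)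
  have hnd := hl.1
  have hds : d ∉ s := by
    rw [hst] at hnd
    rw [List.nodup_append] at hnd
    intro h1
    exact hnd.2.2 d h1 d (by simp) rfl
  have hcl := hl.2 c
  rw [hst] at hcl
  rw [hst, List.erase_append_right _ hds, List.erase_cons_head, List.idxOf_cons_ne _ hne.symm,
    List.idxOf_append_of_notMem hds]
  by_cases hcs : c ∈ s
  · have := List.idxOf_lt_length_of_mem hcs
    rw [List.idxOf_append_of_mem hcs, List.idxOf_append_of_mem hcs]
    simp [this]
  · rw [List.idxOf_append_of_notMem hcs, List.idxOf_append_of_notMem hcs,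
      List.idxOf_cons_ne _ hne.symm]
    simp
    omega

theorem mem_take_idx {C : Type*} [DecidableEq C] (l : List C) (hl : IsOrdering l) (c : C) (p : ℕ) :
    c ∈ l.take p ↔ l.idxOf c < p := by
  have hlt := List.idxOf_lt_length_of_mem (hl.2 c)
  rw [List.mem_take_iff_getElem]
  constructor
  · rintro ⟨i, hi, rfl⟩
    rw [hl.1.idxOf_getElem]; omega
  · intro h
    exact ⟨l.idxOf c, by omega, List.getElem_idxOf hlt⟩

theorem lar_main {V C : Type*} [Fintype C] [DecidableEq C] (γC : V → Finset C) (φ : ELForm C)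
    (p : ℕ → V) (l : ℕ → List C) (hl : ∀ i, IsOrdering (l i))
    (hs : ∀ i, l (i+1) = larUpd (l i) (γC (p i)))
    (hw : ParityWinsPlay (larPrio γC φ) (fun i => (p i, l i))) : ELWinsPlay γC φ p := by
  obtain ⟨m, ⟨k, hk⟩, hfr, hev⟩ := hw
  have hpr : ∀ i, larPrio γC φ (p i, l i) = 2 * larPos (l i) (γC (p i)) ∧
      ELForm.sat (fun c => c ∈ (l i).take (larPos (l i) (γC (p i)))) φ ∨
      larPrio γC φ (p i, l i) = 2 * larPos (l i) (γC (p i)) + 1 := by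
    intro i
    unfold larPrio
    dsimp only
    split_ifs with h
    · exact Or.inl ⟨rfl, h⟩
    · exact Or.inr rfl
  have hlen : ∀ i, (l i).length ≤ Fintype.card C := fun i => (hl i).1.length_le_card
  have hposb : ∀ i, larPos (l i) (γC (p i)) ≤ Fintype.card C := by
    intro i
    rcases larUpd_cases (l i) (hl i) (γC (p i)) with ⟨_, h, _⟩ | ⟨d, _, h, _, _⟩
    · omega
    · have := List.idxOf_lt_length_of_mem ((hl i).2 d)
      have := hlen i
      omega
  have hev' : ∀ᶠ i in atTop, ∀ q ∈ Finset.Ioc m (2 * Fintype.card C + 1),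
      larPrio γC φ (p i, l i) ≠ q := by
    rw [Filter.eventually_all_finset]
    intro q hq
    exact hev q (Finset.mem_Ioc.1 hq).1
  obtain ⟨N, hN⟩ := eventually_atTop.1 hev'
  have hle : ∀ i ≥ N, larPos (l i) (γC (p i)) ≤ k := by
    intro i hi
    by_contra hlt
    have hb := hposb i
    refine hN i hi _ (Finset.mem_Ioc.2 ?_) rfl
    rcases hpr i with ⟨h, _⟩ | h <;> omega
  have hfr' : ∃ᶠ i in atTop, larPos (l i) (γC (p i)) = k ∧
      ELForm.sat (fun c => c ∈ (l i).take k) φ := by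
    refine hfr.mono ?_
    intro i hi
    rcases hpr i with ⟨h, h2⟩ | h
    · have : larPos (l i) (γC (p i)) = k := by dsimp only at hi; omega
      rw [this] at h2
      exact ⟨this, h2⟩
    · dsimp only at hi; omega
  -- one step facts
  have hstep1 : ∀ i ≥ N, ∀ c, k ≤ (l i).idxOf c → (l (i+1)).idxOf c = (l i).idxOf c ∧
      c ∉ γC (p i) := by
    intro i hi c hc
    have := hle i hi
    rcases larUpd_cases (l i) (hl i) (γC (p i)) with ⟨h0, h1, h2⟩ | ⟨d, hd, h1, h2, h3⟩
    · rw [hs, h2, h0]; simp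
    · have hne : c ≠ d := by rintro rfl; omega
      rw [hs, h3, idx_upd _ (hl i) d c hne, if_neg (by omega)]
      refine ⟨rfl, fun h => ?_⟩
      have := h2 c h
      omega
  have hstep2 : ∀ i ≥ N, ∀ c, (l i).idxOf c < k → (l (i+1)).idxOf c < k := by
    intro i hi c hc
    have := hle i hi
    rcases larUpd_cases (l i) (hl i) (γC (p i)) with ⟨h0, h1, h2⟩ | ⟨d, hd, h1, h2, h3⟩
    · rw [hs, h2]; exact hc
    · by_cases hne : c = d
      · subst hne
        rw [hs, h3, List.idxOf_cons_self]; omega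
      · rw [hs, h3, idx_upd _ (hl i) d c hne]
        split_ifs <;> omega
  have hstep3 : ∀ i, ∀ c, c ∉ γC (p i) → (l i).idxOf c ≤ (l (i+1)).idxOf c ∧
      (larPos (l i) (γC (p i)) = k → (l i).idxOf c < k →
        (l i).idxOf c < (l (i+1)).idxOf c) := by
    intro i c hc
    rcases larUpd_cases (l i) (hl i) (γC (p i)) with ⟨h0, h1, h2⟩ | ⟨d, hd, h1, h2, h3⟩
    · rw [hs, h2]; exact ⟨le_rfl, fun _ _ => by omega⟩
    · have hne : c ≠ d := by rintro rfl; exact hc hd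
      have hidx : (l i).idxOf c ≠ (l i).idxOf d := fun h =>
        hne ((List.idxOf_inj ((hl i).2 c)).1 h)
      rw [hs, h3, idx_upd _ (hl i) d c hne]
      split_ifs
      · exact ⟨by omega, fun _ _ => by omega⟩
      · exact ⟨by omega, fun _ _ => by omega⟩
  have hconst : ∀ i ≥ N, ∀ c, (l i).idxOf c < k ↔ (l N).idxOf c < k := by
    intro i hi c
    induction i, hi using Nat.le_induction with
    | base => rfl
    | succ i hi ih =>
      rw [← ih]
      refine ⟨fun h => ?_, hstep2 i hi c⟩
      by_contra h'
      have := (hstep1 i hi c (by omega)).1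
      omega
  have hinf : ∀ c, (∃ᶠ i in atTop, c ∈ γC (p i)) ↔ (l N).idxOf c < k := by
    intro c
    constructor
    · intro h
      obtain ⟨i, hi, hci⟩ := frequently_atTop.1 h N
      rw [← hconst i hi c]
      by_contra h'
      exact (hstep1 i hi c (by omega)).2 hci
    · intro h
      by_contra hnf
      obtain ⟨N', hN'⟩ := eventually_atTop.1 (not_frequently.1 hnf)
      have hmono : ∀ a ≥ N', ∀ b ≥ a, (l a).idxOf c ≤ (l b).idxOf c := by
        intro a ha b hb
        induction b, hb using Nat.le_induction with
        | base => rfl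
        | succ b hb ih => exact ih.trans (hstep3 b c (hN' b (by omega))).1
      have hgrow : ∀ n : ℕ, ∃ i ≥ max N N', n ≤ (l i).idxOf c := by
        intro n
        induction n with
        | zero => exact ⟨_, le_rfl, Nat.zero_le _⟩
        | succ n ih =>
          obtain ⟨i, hi, hn⟩ := ih
          obtain ⟨j, hj, hpj, _⟩ := frequently_atTop.1 hfr' i
          have h1 := hmono i (by omega) j hj
          have h2 := (hstep3 j c (hN' j (by omega))).2 hpj ((hconst j (by omega) c).2 h)
          exact ⟨j+1, by omega, by omega⟩
      obtain ⟨i, hi, hki⟩ := hgrow k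
      have := (hconst i (by omega) c).2 h
      omega
  obtain ⟨i, hi, _, hsat⟩ := frequently_atTop.1 hfr' N
  unfold ELWinsPlay
  convert hsat using 2 with c
  rw [hinf, mem_take_idx _ (hl i), hconst i hi]

/-- Backward direction of the LAR reduction: if player ∃ has a positional winning strategy
in the parity game `P(G)` from a node `(v,π)` (with `π` a permutation of `C`), then player
∃ has a winning strategy with memory `Π(C)` in the Emerson-Lei game `G` from `v`; in
particular `v ∈ Win_G`. -/
theorem statement7 {V C : Type*} [Fintype C] [DecidableEq C]
    (Vex : Set V) (E : V → Set V) (hNE : ∀ v : V, (E v).Nonempty)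
    (γC : V → Finset C) (φ : ELForm C)
    (v : V) (π0 : List C) (hπ0 : IsOrdering π0)
    (hwin : PosWinsFrom (prodVex C Vex) (prodE E γC)
      (ParityWinsPlay (larPrio γC φ)) (v, π0)) :
    (∃ (m0 : {l : List C // IsOrdering l})
        (upd : {l : List C // IsOrdering l} → V × V → {l : List C // IsOrdering l})
        (mov : V → {l : List C // IsOrdering l} → V),
      MemWinsFrom Vex E (ELWinsPlay γC φ) m0 upd mov v) ∧
    WinsFrom Vex E (ELWinsPlay γC φ) v := by
  obtain ⟨σ, hσ, _, hσw⟩ := hwin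
  let upd : {l : List C // IsOrdering l} → V × V → {l : List C // IsOrdering l} :=
    fun m e => ⟨larUpd m.1 (γC e.1), larUpd_ord m.1 m.2 _⟩
  let mov : V → {l : List C // IsOrdering l} → V := fun u m => (σ (u, m.1)).1
  let m0 : {l : List C // IsOrdering l} := ⟨π0, hπ0⟩
  have hσE : ∀ (u : V) (l : List C), u ∈ Vex → σ (u, l) ∈ prodE E γC (u, l) := by
    intro u l hu
    obtain ⟨w, hw⟩ := hNE u
    exact hσ (u, l) hu ⟨(w, larUpd l (γC u)), w, hw, rfl⟩
  have hmov : ∀ (u : V) (m : {l : List C // IsOrdering l}), u ∈ Vex → mov u m ∈ E u := by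
    intro u m hu
    obtain ⟨w, hw, he⟩ := hσE u m.1 hu
    show (σ (u, m.1)).1 ∈ E u
    rw [he]; exact hw
  have hplay : ∀ π : ℕ → V, π 0 = v → (∀ i, π (i+1) ∈ E (π i)) →
      (∀ i, π i ∈ Vex → π (i+1) = mov (π i) (memAt upd m0 π i)) → ELWinsPlay γC φ π := by
    intro π h0 hE hc
    refine lar_main γC φ π (fun i => (memAt upd m0 π i).1) (fun i => (memAt upd m0 π i).2)
      (fun i => rfl) ?_
    apply hσw
    · show (π 0, π0) = (v, π0)
      rw [h0]
    · intro i
      exact ⟨π (i+1), hE i, rfl⟩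
    · intro i hi
      obtain ⟨w, hw, he⟩ := hσE (π i) (memAt upd m0 π i).1 hi
      have h1 : π (i+1) = (σ (π i, (memAt upd m0 π i).1)).1 := hc i hi
      show (π (i+1), larUpd (memAt upd m0 π i).1 (γC (π i))) = σ (π i, (memAt upd m0 π i).1)
      rw [h1, he]
  refine ⟨⟨m0, upd, mov, fun u m hu _ => hmov u m hu, fun p n _ _ _ _ => hNE _, hplay⟩, ?_⟩
  refine ⟨fun h u => mov u (h.foldl (fun m w => upd m (w, w)) m0),
    fun h u hu _ => hmov u _ hu, fun p n _ _ _ _ => hNE _, ?_⟩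
  intro π h0 hE hc
  refine hplay π h0 hE ?_
  have hmem : ∀ i, (histList π i).foldl (fun m w => upd m (w, w)) m0 = memAt upd m0 π i := by
    intro i
    induction i with
    | zero => rfl
    | succ i ih =>
      have : histList π (i+1) = histList π i ++ [π i] := by
        unfold histList
        rw [List.ofFn_succ_last]
        simp
      rw [this, List.foldl_append, ih]
      rfl
  intro i hi
  rw [hc i hi, ← hmem]
end

section
/- Let C be a finite set, let (D_i)_{i∈ℕ} be a sequence of subsets of C, let I={c∈C | c∈D_i for infinitely many i} and p=|I|, and let π_0 be any permutation of C with π_{i+1}=π_i@D_i for all i≥0. Then there exists j such that for all j'≥j, the set of elements at the first p positions of π_{j'} is exactly I, i.e. π_{j'}[p]=I. -/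
open Filter

theorem larUpd_decomp {C : Type*} [DecidableEq C] (l : List C) (D : Finset C)
    (hall : ∀ c : C, c ∈ l) (hnd : l.Nodup) :
    (D = ∅ ∧ larUpd l D = l) ∨ ∃ s m t, l = s ++ m :: t ∧ m ∈ D ∧ (∀ x ∈ t, x ∉ D) ∧
      larUpd l D = m :: (s ++ t) := by
  unfold larUpd
  rcases h : (l.filter fun c => decide (c ∈ D)).getLast? with _ | m
  · left
    simp only [List.getLast?_eq_none_iff, List.filter_eq_nil_iff] at h
    refine ⟨?_, rfl⟩
    ext x
    simpa using h x (hall x)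
  · right
    rw [List.getLast?_eq_some_iff] at h
    obtain ⟨f, hf⟩ := h
    rw [List.filter_eq_append_iff] at hf
    obtain ⟨l1, l2, rfl, h1, h2⟩ := hf
    rw [List.filter_eq_cons_iff] at h2
    obtain ⟨a, b, rfl, ha, hm, hb⟩ := h2
    refine ⟨l1 ++ a, m, b, by simp, by simpa using hm, by simpa using hb, ?_⟩
    have : m ∉ l1 ++ a := by
      intro hh
      rw [← List.append_assoc] at hnd
      have := List.nodup_append.1 hnd
      exact this.2.2 m hh m (by simp) rfl
    simp only
    rw [← List.append_assoc, List.erase_append_right _ this]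
    simp

theorem larUpd_pos {C : Type*} [DecidableEq C] (l : List C) (D : Finset C)
    (hall : ∀ c : C, c ∈ l) (hnd : l.Nodup) :
    ((larUpd l D).Nodup ∧ (∀ c : C, c ∈ larUpd l D)) ∧
    ((D = ∅ ∧ larUpd l D = l) ∨ ∃ m ∈ D, (∀ x ∈ D, l.idxOf x ≤ l.idxOf m) ∧
      (∀ x, x ≠ m → l.idxOf x < l.idxOf m → (larUpd l D).idxOf x = l.idxOf x + 1) ∧
      (∀ x, l.idxOf m < l.idxOf x → (larUpd l D).idxOf x = l.idxOf x)) := by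
  rcases larUpd_decomp l D hall hnd with ⟨h1, h2⟩ | ⟨s, m, t, rfl, hm, ht, h⟩
  · rw [h2]; exact ⟨⟨hnd, hall⟩, Or.inl ⟨h1, rfl⟩⟩
  · rw [h]
    have hp : (s ++ m :: t).Perm (m :: (s ++ t)) := List.perm_middle
    refine ⟨⟨hp.nodup_iff.1 hnd, fun c => hp.mem_iff.1 (hall c)⟩, Or.inr ⟨m, hm, ?_⟩⟩
    have hms : m ∉ s := by
      have := hp.nodup_iff.1 hnd
      simp at this; tauto
    refine ⟨?_, ?_, ?_⟩
    · intro x hx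
      have hxt : x ∉ t := fun h => ht x h hx
      have := hall x
      by_cases hxs : x ∈ s
      · have := List.idxOf_lt_length_of_mem hxs
        simp [List.idxOf_append, hxs, hms]; omega
      · have : x = m := by simp_all
        rw [this]
    · intro x hxm hlt
      by_cases hxs : x ∈ s
      · simp [List.idxOf_append, hxs, List.idxOf_cons, hxm.symm]
      · simp [List.idxOf_append, hxs, hms] at hlt
    · intro x hlt
      by_cases hxs : x ∈ s
      · have := List.idxOf_lt_length_of_mem hxs
        simp [List.idxOf_append, hxs, hms] at hlt; omega
      · have hxm : m ≠ x := by rintro rfl; omega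
        simp [List.idxOf_append, hxs, List.idxOf_cons, hxm]; omega

theorem take_eq_of_sep {C : Type*} [DecidableEq C] [Fintype C] (l : List C) (I : Set C)
    (hall : ∀ c : C, c ∈ l) (hnd : l.Nodup)
    (hsep : ∀ c ∈ I, ∀ d ∉ I, l.idxOf c < l.idxOf d) (c : C) :
    c ∈ l.take I.ncard ↔ c ∈ I := by
  rw [List.mem_take_iff_idxOf_lt (hall c)]
  have hcard : ∀ k ≤ l.length, ((l.take k).toFinset : Set C).ncard = k := by
    intro k hk
    rw [Set.ncard_coe_finset, List.toFinset_card_of_nodup (hnd.sublist (List.take_sublist _ _))]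
    simp [hk]
  have hlen := List.idxOf_lt_length_of_mem (hall c)
  constructor
  · intro h
    by_contra hc
    have hsub : I ⊆ ((l.take (l.idxOf c)).toFinset : Set C) := by
      intro x hx
      simp only [List.coe_toFinset, Set.mem_ofPred_eq]
      rw [List.mem_take_iff_idxOf_lt (hall x)]
      exact hsep x hx c hc
    have := Set.ncard_le_ncard hsub (Set.toFinite _)
    rw [hcard _ hlen.le] at this
    omega
  · intro hc
    have hsub : ((l.take (l.idxOf c + 1)).toFinset : Set C) ⊆ I := by
      intro x hx
      simp only [List.coe_toFinset, Set.mem_ofPred_eq] at hx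
      rw [List.mem_take_iff_idxOf_lt (hall x)] at hx
      by_contra hxI
      have := hsep c hc x hxI
      omega
    have := Set.ncard_le_ncard hsub (Set.toFinite _)
    rw [hcard _ hlen] at this
    omega

theorem eventually_const_of_mono (f : ℕ → ℕ) (B j0 : ℕ) (hB : ∀ i, f i ≤ B)
    (hm : ∀ i ≥ j0, f i ≤ f (i+1)) : ∀ᶠ i in atTop, f (i+1) = f i := by
  by_contra h
  rw [not_eventually] at h; have h' := h
  rw [frequently_atTop] at h'
  have hmono : ∀ i j, j0 ≤ i → i ≤ j → f i ≤ f j := by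
    intro i j hi hij
    induction j, hij using Nat.le_induction with
    | base => exact le_rfl
    | succ n hn ih => exact ih.trans (hm n (by omega))
  have : ∀ k, ∃ i ≥ j0, k ≤ f i := by
    intro k
    induction k with
    | zero => exact ⟨j0, le_rfl, by omega⟩
    | succ k ih =>
      obtain ⟨i, hi, hk⟩ := ih
      obtain ⟨i', hi', hne⟩ := h' i
      have h1 := hmono i i' hi hi'
      have h2 := hm i' (by omega)
      exact ⟨i'+1, by omega, by omega⟩
  obtain ⟨i, _, hi⟩ := this (B+1)
  have := hB i
  omega

theorem statement11 {C : Type*} [Fintype C] [DecidableEq C]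
    (D : ℕ → Finset C) (π : ℕ → List C)
    (hnd : (π 0).Nodup) (hall : ∀ c : C, c ∈ π 0)
    (hstep : ∀ i, π (i+1) = larUpd (π i) (D i)) :
    ∃ j, ∀ j', j ≤ j' → ∀ c : C,
      c ∈ (π j').take ({c' : C | ∃ᶠ i in atTop, c' ∈ D i}.ncard) ↔
        c ∈ {c' : C | ∃ᶠ i in atTop, c' ∈ D i} := by
  have hinv : ∀ i, (π i).Nodup ∧ ∀ c : C, c ∈ π i := by
    intro i
    induction i with
    | zero => exact ⟨hnd, hall⟩
    | succ i ih => rw [hstep]; exact (larUpd_pos _ _ ih.2 ih.1).1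
  have hpos := fun i => (larUpd_pos (π i) (D i) (hinv i).2 (hinv i).1).2
  simp only [← hstep] at hpos
  have hinj : ∀ i x y, (π i).idxOf x = (π i).idxOf y → x = y := fun i x y h =>
    (List.idxOf_inj ((hinv i).2 x)).1 h
  set I : Set C := {c' : C | ∃ᶠ i in atTop, c' ∈ D i} with hI
  have hev : ∀ d : C, d ∉ I → ∀ᶠ i in atTop, d ∉ D i := by
    intro d hd
    simpa [hI, not_frequently] using hd
  have hstab : ∀ d : C, ∀ᶠ i in atTop, d ∉ I → (π (i+1)).idxOf d = (π i).idxOf d := by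
    intro d
    by_cases hd : d ∈ I
    · simp [hd]
    obtain ⟨j0, hj0⟩ := eventually_atTop.1 (hev d hd)
    have := eventually_const_of_mono (fun i => (π i).idxOf d) (Fintype.card C) j0
      (fun i => List.idxOf_le_length.trans (hinv i).1.length_le_card) (by
        intro i hi
        rcases hpos i with ⟨_, h⟩ | ⟨m, hm, _, h2, h3⟩
        · simp [h]
        · have hne : d ≠ m := by rintro rfl; exact hj0 i hi hm
          rcases lt_trichotomy ((π i).idxOf d) ((π i).idxOf m) with h | h | h
          · simp [h2 d hne h]
          · exact absurd (hinj i _ _ h) hne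
          · simp [h3 d h])
    filter_upwards [this] with i hi _ using hi
  obtain ⟨j, hj⟩ := eventually_atTop.1 (eventually_all.2 hstab)
  refine ⟨j, fun j' hj' c => take_eq_of_sep _ _ (hinv j').2 (hinv j').1 ?_ c⟩
  intro c hc d hd
  by_contra hlt
  have hcd : c ≠ d := by rintro rfl; exact hd hc
  have key : ∀ i ≥ j, ∀ m, (∀ x, x ≠ m → (π i).idxOf x < (π i).idxOf m →
      (π (i+1)).idxOf x = (π i).idxOf x + 1) → (π i).idxOf m ≤ (π i).idxOf d := by
    intro i hi m h2
    by_contra hh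
    have := h2 d (by rintro rfl; omega) (by omega)
    have := hj i hi d hd
    omega
  have hbeh : ∀ i ≥ j', (π i).idxOf d < (π i).idxOf c := by
    intro i hi
    induction i, hi using Nat.le_induction with
    | base =>
      have : (π j').idxOf c ≠ (π j').idxOf d := fun h => hcd (hinj _ _ _ h)
      omega
    | succ i hi ih =>
      rcases hpos i with ⟨_, h⟩ | ⟨m, hm, _, h2, h3⟩
      · rw [h]; exact ih
      · have := key i (by omega) m h2
        rw [h3 c (by omega), hj i (by omega) d hd]
        exact ih
  obtain ⟨i, hi, hci⟩ := frequently_atTop.1 hc j'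
  rcases hpos i with ⟨h, _⟩ | ⟨m, hm, h1, h2, h3⟩
  · simp [h] at hci
  · have := key i (by omega) m h2
    have := h1 c hci
    have := hbeh i hi
    omega
end

section
/- Let C be a finite set, let (D_i)_{i∈ℕ} be a sequence of subsets of C with I={c∈C | c∈D_i for infinitely many i} nonempty and p=|I|, let π_0 be any permutation of C with π_{i+1}=π_i@D_i for all i≥0, and for each i with D_i≠∅ let h_i be the rightmost position of π_i containing an element of D_i. Then there exists j such that h_i≤p for all i≥j with D_i≠∅, and h_i=p for infinitely many i. -/
open Filter

theorem aux_erase {C : Type*} [DecidableEq C] (l : List C) (c m : C) (h : c ≠ m) :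
    m ∈ l →
    (l.idxOf c < l.idxOf m → (l.erase m).idxOf c = l.idxOf c) ∧
    (l.idxOf m < l.idxOf c → (l.erase m).idxOf c + 1 = l.idxOf c) := by
  induction l with
  | nil => simp
  | cons a t ih =>
    intro hm
    by_cases ham : a = m
    · subst ham
      simp [List.idxOf_cons_ne _ (Ne.symm h)]
    · have hmt : m ∈ t := by
        rcases List.mem_cons.1 hm with h1 | h1
        · exact absurd h1.symm ham
        · exact h1
      rw [List.erase_cons_tail (by simpa using ham)]
      by_cases hac : a = c
      · subst hac
        simp
      · rw [List.idxOf_cons_ne _ hac, List.idxOf_cons_ne _ hac, List.idxOf_cons_ne _ ham]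
        have := ih hmt
        constructor
        · intro h1
          have := this.1 (by omega)
          omega
        · intro h1
          have := this.2 (by omega)
          omega

theorem aux_max {C : Type*} [DecidableEq C] (D : Finset C) (l : List C) (m d : C) :
    l.Nodup → (l.filter fun c => decide (c ∈ D)).getLast? = some m → d ∈ l → d ∈ D →
    l.idxOf d ≤ l.idxOf m := by
  induction l with
  | nil => simp
  | cons a t ih =>
    intro hn hm hd hD
    by_cases had : a = d
    · subst had; simp
    · have hdt : d ∈ t := by
        rcases List.mem_cons.1 hd with h1 | h1
        · exact absurd h1.symm had
        · exact h1
      have hne : (t.filter fun c => decide (c ∈ D)) ≠ [] := by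
        intro h0
        have : d ∈ (t.filter fun c => decide (c ∈ D)) := by simp [hdt, hD]
        rw [h0] at this; simp at this
      have hm' : (t.filter fun c => decide (c ∈ D)).getLast? = some m := by
        by_cases haD : a ∈ D
        · rw [List.filter_cons_of_pos (by simpa using haD)] at hm
          obtain ⟨b, s, hs⟩ := List.exists_cons_of_ne_nil hne
          rw [hs] at hm ⊢
          simpa using hm
        · rwa [List.filter_cons_of_neg (by simpa using haD)] at hm
      have hmt : m ∈ t := (List.mem_filter.1 (List.mem_of_getLast? hm')).1
      have ham : a ≠ m := by
        rintro rfl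
        exact (List.nodup_cons.1 hn).1 hmt
      rw [List.idxOf_cons_ne _ had, List.idxOf_cons_ne _ ham]
      have := ih (List.nodup_cons.1 hn).2 hm' hdt hD
      omega

theorem aux_step {C : Type*} [DecidableEq C] (D : Finset C) (l : List C)
    (hn : l.Nodup) (hall : ∀ c, c ∈ l) :
    ((larUpd l D).Nodup ∧ ∀ c, c ∈ larUpd l D) ∧
    (D = ∅ → larUpd l D = l) ∧
    (D.Nonempty → ∃ m ∈ D, larPos l D = l.idxOf m + 1 ∧ (∀ d ∈ D, l.idxOf d ≤ l.idxOf m) ∧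
      (∀ c, l.idxOf c < l.idxOf m → (larUpd l D).idxOf c = l.idxOf c + 1) ∧
      (∀ c, l.idxOf m < l.idxOf c → (larUpd l D).idxOf c = l.idxOf c)) := by
  rcases hm : (l.filter fun c => decide (c ∈ D)).getLast? with _ | m
  · have hu : larUpd l D = l := by unfold larUpd; rw [hm]
    rw [hu]
    refine ⟨⟨hn, hall⟩, fun _ => rfl, ?_⟩
    rintro ⟨d, hd⟩
    exfalso
    rw [List.getLast?_eq_none_iff, List.filter_eq_nil_iff] at hm
    exact hm d (hall d) (by simpa using hd)
  · have hu : larUpd l D = m :: l.erase m := by unfold larUpd; rw [hm]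
    have hp : larPos l D = l.idxOf m + 1 := by unfold larPos; rw [hm]
    have hmD : m ∈ D := by
      simpa using (List.mem_filter.1 (List.mem_of_getLast? hm)).2
    have hperm := List.perm_cons_erase (hall m)
    rw [hu, hp]
    refine ⟨⟨hperm.nodup_iff.1 hn, fun c => hperm.mem_iff.1 (hall c)⟩, ?_, ?_⟩
    · rintro rfl; simp at hmD
    · intro _
      refine ⟨m, hmD, rfl, fun d hd => aux_max D l m d hn hm (hall d) hd, ?_, ?_⟩
      · intro c hc
        have hcm : c ≠ m := by rintro rfl; omega
        rw [List.idxOf_cons_ne _ hcm.symm, (aux_erase l c m hcm (hall m)).1 hc]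
      · intro c hc
        have hcm : c ≠ m := by rintro rfl; omega
        rw [List.idxOf_cons_ne _ hcm.symm]
        exact (aux_erase l c m hcm (hall m)).2 hc

theorem aux_stab (B : ℕ) : ∀ (f : ℕ → ℕ) (j : ℕ), (∀ i, j ≤ i → f i ≤ f (i+1)) →
    (∀ i, f i ≤ B) → ∀ᶠ i in atTop, f (i+1) = f i := by
  intro f j hmono hB
  by_contra hcon
  have hfr : ∀ n, ∃ i, n ≤ i ∧ f (i+1) ≠ f i := by
    intro n
    exact (Filter.frequently_atTop.1 (Filter.not_eventually.1 hcon)) n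
  have hm : ∀ a, j ≤ a → ∀ b, a ≤ b → f a ≤ f b := by
    intro a ha b hab
    induction b, hab using Nat.le_induction with
    | base => rfl
    | succ b hb ih => exact ih.trans (hmono b (by omega))
  have : ∀ k, ∃ i, j ≤ i ∧ k ≤ f i := by
    intro k
    induction k with
    | zero => exact ⟨j, le_rfl, by omega⟩
    | succ k ih =>
      obtain ⟨i, hi, hk⟩ := ih
      obtain ⟨i', hi', hne⟩ := hfr i
      have h1 := hm i hi i' hi'
      have h2 := hmono i' (by omega)
      exact ⟨i'+1, by omega, by omega⟩
  obtain ⟨i, _, hi⟩ := this (B+1)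
  have := hB i
  omega

theorem statement12 {C : Type*} [Fintype C] [DecidableEq C]
    (D : ℕ → Finset C) (π : ℕ → List C)
    (hnd : (π 0).Nodup) (hall : ∀ c : C, c ∈ π 0)
    (hstep : ∀ i, π (i+1) = larUpd (π i) (D i))
    (hI : {c : C | ∃ᶠ i in atTop, c ∈ D i}.Nonempty) :
    ∃ j, (∀ i, j ≤ i → (D i).Nonempty →
        larPos (π i) (D i) ≤ {c : C | ∃ᶠ n in atTop, c ∈ D n}.ncard) ∧
      (∃ᶠ i in atTop, (D i).Nonempty ∧
        larPos (π i) (D i) = {c : C | ∃ᶠ n in atTop, c ∈ D n}.ncard) := by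
  classical
  have hgood : ∀ i, (π i).Nodup ∧ ∀ c, c ∈ π i := by
    intro i
    induction i with
    | zero => exact ⟨hnd, hall⟩
    | succ i ih => rw [hstep]; exact (aux_step (D i) (π i) ih.1 ih.2).1
  set I : Finset C := Finset.univ.filter (fun c => ∃ᶠ n in atTop, c ∈ D n) with hIdef
  have hmemI : ∀ c, c ∈ I ↔ ∃ᶠ n in atTop, c ∈ D n := by intro c; simp [hIdef]
  have hset : {c : C | ∃ᶠ n in atTop, c ∈ D n} = (I : Set C) := by
    ext c; simp [hIdef]
  rw [hset] at hI ⊢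
  rw [Set.ncard_coe_finset]
  have hIne : I.Nonempty := by simpa using hI
  obtain ⟨pos, hpos⟩ : ∃ pos : ℕ → C → ℕ, ∀ i c, pos i c = (π i).idxOf c := ⟨_, fun _ _ => rfl⟩
  have hinj : ∀ i c d, pos i c = pos i d → c = d := by
    intro i c d h
    rw [hpos, hpos] at h
    exact (List.idxOf_inj ((hgood i).2 c)).1 h
  have hlen : ∀ i, (π i).length = Fintype.card C := by
    intro i
    rw [← List.toFinset_card_of_nodup (hgood i).1, ← Finset.card_univ]
    congr 1
    ext c; simp [(hgood i).2 c]
  have hlt : ∀ i c, pos i c < Fintype.card C := by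
    intro i c
    rw [hpos, ← hlen i]
    exact List.idxOf_lt_length_iff.2 ((hgood i).2 c)
  have hsurj : ∀ i k, k < Fintype.card C → ∃ c, pos i c = k := by
    intro i k hk
    rw [← hlen i] at hk
    exact ⟨(π i)[k], by rw [hpos]; exact (hgood i).1.idxOf_getElem k hk⟩
  have hE : ∀ i, D i = ∅ → ∀ c, pos (i+1) c = pos i c := by
    intro i h c
    rw [hpos, hpos, hstep, (aux_step (D i) (π i) (hgood i).1 (hgood i).2).2.1 h]
  have hN : ∀ i, (D i).Nonempty → ∃ m ∈ D i, larPos (π i) (D i) = pos i m + 1 ∧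
      (∀ d ∈ D i, pos i d ≤ pos i m) ∧
      (∀ c, pos i c < pos i m → pos (i+1) c = pos i c + 1) ∧
      (∀ c, pos i m < pos i c → pos (i+1) c = pos i c) := by
    intro i h
    have := (aux_step (D i) (π i) (hgood i).1 (hgood i).2).2.2 h
    simpa only [hpos, hstep] using this
  -- eventually D i ⊆ I
  have h1 : ∀ᶠ i in atTop, ∀ c, c ∉ I → c ∉ D i := by
    rw [Filter.eventually_all]
    intro c
    by_cases hc : c ∈ I
    · simp [hc]
    · have := hc
      rw [hmemI, Filter.not_frequently] at this
      filter_upwards [this] with i hi _ using hi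
  obtain ⟨j0, hj0⟩ := Filter.eventually_atTop.1 h1
  have h2 : ∀ᶠ i in atTop, ∀ c, c ∉ I → pos (i+1) c = pos i c := by
    rw [Filter.eventually_all]
    intro c
    by_cases hc : c ∈ I
    · simp [hc]
    · have := aux_stab (Fintype.card C) (fun i => pos i c) j0 ?_ (fun i => (hlt i c).le)
      · filter_upwards [this] with i hi _ using hi
      · intro i hi
        show pos i c ≤ pos (i+1) c
        rcases (D i).eq_empty_or_nonempty with h | h
        · rw [hE i h]
        · obtain ⟨m, hm, -, -, ha, hb⟩ := hN i h
          rcases lt_trichotomy (pos i c) (pos i m) with h3 | h3 | h3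
          · rw [ha c h3]; omega
          · exact absurd (hinj _ _ _ h3 ▸ hm) (hj0 i hi c hc)
          · rw [hb c h3]
  obtain ⟨j1, hj1⟩ := Filter.eventually_atTop.1 h2
  have hA : ∀ i, max j0 j1 ≤ i → ∀ c, c ∉ I → ∀ x ∈ I, pos i x < pos i c := by
    intro i hi c hc x hx
    by_contra hcon
    have hne : pos i x ≠ pos i c := by
      intro h
      exact hc (hinj _ _ _ h ▸ hx)
    have hmc : ∀ k, i ≤ k → ∀ m ∈ D k, (∀ c, pos k c < pos k m → pos (k+1) c = pos k c + 1) →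
        pos k m < pos k c := by
      intro k hk m hm ha
      have h3 := hj1 k (by omega) c hc
      by_contra h4
      have h5 : pos k c ≠ pos k m := fun h =>
        hj0 k (by omega) c hc (hinj _ _ _ h ▸ hm)
      have := ha c (by omega)
      omega
    have hk : ∀ k, i ≤ k → pos k c < pos k x := by
      intro k hk
      induction k, hk using Nat.le_induction with
      | base => omega
      | succ k hk ih =>
        rcases (D k).eq_empty_or_nonempty with h | h
        · rw [hE k h, hE k h]; exact ih
        · obtain ⟨m, hm, -, -, ha, hb⟩ := hN k h
          have := hmc k hk m hm ha
          rw [hb c this, hb x (by omega)]; exact ih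
    obtain ⟨k, hik, hxk⟩ := Filter.frequently_atTop.1 ((hmemI x).1 hx) i
    obtain ⟨m, hm, -, hmax, ha, hb⟩ := hN k ⟨x, hxk⟩
    have h3 := hmc k hik m hm ha
    have h4 := hmax x hxk
    have h5 := hk k hik
    omega
  have hle : ∀ i, max j0 j1 ≤ i → (D i).Nonempty → larPos (π i) (D i) ≤ I.card := by
    intro i hi hne
    obtain ⟨m, hm, hp, -⟩ := hN i hne
    rw [hp]
    have hmI : m ∈ I := by
      by_contra h
      exact hj0 i (by omega) m h hm
    have hsub : Finset.range (pos i m + 1) ⊆ I.image (pos i) := by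
      intro k hk
      rw [Finset.mem_range] at hk
      have := hlt i m
      obtain ⟨c, hc⟩ := hsurj i k (by omega)
      refine Finset.mem_image.2 ⟨c, ?_, hc⟩
      by_contra hcI
      have := hA i hi c hcI m hmI
      omega
    have := (Finset.card_le_card hsub).trans Finset.card_image_le
    simpa using this
  refine ⟨max j0 j1, hle, ?_⟩
  by_contra hcon
  rw [Filter.not_frequently] at hcon
  obtain ⟨j2, hj2⟩ := Filter.eventually_atTop.1 hcon
  obtain ⟨J, hJ⟩ : ∃ J, J = max (max j0 j1) j2 := ⟨_, rfl⟩
  obtain ⟨x, hx, hxmax⟩ := Finset.exists_max_image I (pos J) hIne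
  have hcard : I.card ≤ pos J x + 1 := by
    have hsub : I.image (pos J) ⊆ Finset.range (pos J x + 1) := by
      intro k hk
      obtain ⟨c, hc, rfl⟩ := Finset.mem_image.1 hk
      have := hxmax c hc
      rw [Finset.mem_range]; omega
    have := Finset.card_le_card hsub
    rw [Finset.card_image_of_injective _ (fun a b h => hinj J a b h), Finset.card_range] at this
    exact this
  have hlt' : ∀ k, J ≤ k → (D k).Nonempty → larPos (π k) (D k) < I.card := by
    intro k hk hne
    have h3 := hle k (by omega) hne
    have h4 : larPos (π k) (D k) ≠ I.card := fun h => hj2 k (by omega) ⟨hne, h⟩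
    omega
  have hk : ∀ k, J ≤ k → pos k x = pos J x := by
    intro k hk
    induction k, hk using Nat.le_induction with
    | base => rfl
    | succ k hk ih =>
      rcases (D k).eq_empty_or_nonempty with h | h
      · rw [hE k h]; exact ih
      · have h3 := hlt' k hk h
        obtain ⟨m, hm, hp, -, ha, hb⟩ := hN k h
        rw [hb x (by omega)]; exact ih
  obtain ⟨k, hJk, hxk⟩ := Filter.frequently_atTop.1 ((hmemI x).1 hx) J
  have h3 := hlt' k hJk ⟨x, hxk⟩
  obtain ⟨m, hm, hp, hmax, -⟩ := hN k ⟨x, hxk⟩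
  have h4 := hmax x hxk
  have h5 := hk k hJk
  omega
end
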